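/- arXiv:1710.09700 — 11 statements merged into one kernel-verified Lean document; each statement's English description precedes it below -/
import Mathlib

section
/- Let B10(θ̂) be the conjugate-prior Bayes factor defined below. If ν0 < ν1, then B10(θ̂) → 0 as |θ̂| → ∞; if ν0 > ν1, then B10(θ̂) → ∞ as |θ̂| → ∞. -/
open MeasureTheory Filter Matrix

theorem posDef_quad_bounds {r : ℕ} (hr : 1 ≤ r) (A : Matrix (Fin r) (Fin r) ℝ) (hA : A.PosDef) :
    ∃ c C : ℝ, 0 < c ∧ 0 < C ∧ ∀ x : EuclideanSpace ℝ (Fin r),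
      c * ‖x‖ ^ 2 ≤ x ⬝ᵥ A.mulVec x ∧ x ⬝ᵥ A.mulVec x ≤ C * ‖x‖ ^ 2 := by
  have hpos : ∀ x : EuclideanSpace ℝ (Fin r), x ≠ 0 → 0 < x ⬝ᵥ A.mulVec x := by
    intro x hx
    have h := hA.dotProduct_mulVec_pos (x := (x : Fin r → ℝ)) (by
      intro h0
      apply hx
      ext i
      exact congrFun h0 i)
    simpa using h
  have hcont : Continuous fun x : EuclideanSpace ℝ (Fin r) => x ⬝ᵥ A.mulVec x := by
    simp only [dotProduct, mulVec]
    fun_prop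
  have hcomp : IsCompact (Metric.sphere (0 : EuclideanSpace ℝ (Fin r)) 1) := isCompact_sphere 0 1
  haveI : Nonempty (Fin r) := ⟨⟨0, hr⟩⟩
  have hne : (Metric.sphere (0 : EuclideanSpace ℝ (Fin r)) 1).Nonempty :=
    NormedSpace.sphere_nonempty.mpr zero_le_one
  obtain ⟨x0, hx0, hmin⟩ := hcomp.exists_isMinOn hne hcont.continuousOn
  obtain ⟨x1, hx1, hmax⟩ := hcomp.exists_isMaxOn hne hcont.continuousOn
  have nz : ∀ x ∈ Metric.sphere (0 : EuclideanSpace ℝ (Fin r)) 1, x ≠ 0 := by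
    rintro x hx rfl
    simp at hx
  refine ⟨_, _, hpos x0 (nz x0 hx0), hpos x1 (nz x1 hx1), fun x => ?_⟩
  by_cases hx : x = 0
  · subst hx
    simp
  have hn : 0 < ‖x‖ := norm_pos_iff.mpr hx
  have hmem : (‖x‖⁻¹ • x) ∈ Metric.sphere (0 : EuclideanSpace ℝ (Fin r)) 1 := by
    simp [norm_smul, hn.ne']
  have e : x ⬝ᵥ A.mulVec x =
      ((‖x‖⁻¹ • x : EuclideanSpace ℝ (Fin r)) ⬝ᵥ
        A.mulVec (‖x‖⁻¹ • x : EuclideanSpace ℝ (Fin r))) * ‖x‖ ^ 2 := by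
    simp only [WithLp.ofLp_smul, mulVec_smul, smul_dotProduct, dotProduct_smul, smul_eq_mul]
    field_simp
  rw [e]
  constructor
  · exact mul_le_mul_of_nonneg_right (hmin hmem) (by positivity)
  · exact mul_le_mul_of_nonneg_right (hmax hmem) (by positivity)

/-- For the conjugate-prior Bayes factor, if ν0 < ν1 then B10 → 0 as |θ̂| → ∞,
and if ν0 > ν1 then B10 → ∞ as |θ̂| → ∞. -/
theorem conjugate_bayes_factor_limits
    (n r1 r2 : ℕ) (hn : 1 ≤ n) (hr1 : 1 ≤ r1)
    (Q Ω : Matrix (Fin r1) (Fin r1) ℝ) (hQ : Q.PosDef) (hΩ : Ω.PosDef)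
    (ν0 ν1 : ℝ) (hν0 : 0 ≤ ν0) (hν1 : 0 ≤ ν1)
    (hdf : 0 < (n : ℝ) + min ν0 ν1 - r2)
    (s0sq s1sq : ℝ) (hs0 : 0 < s0sq) (hs1 : 0 < s1sq)
    (sysq : ℝ) (hsy : 0 < sysq)
    (B10 : EuclideanSpace ℝ (Fin r1) → ℝ)
    (hB10 : ∀ θhat : EuclideanSpace ℝ (Fin r1),
      B10 θhat = (Ω + Q⁻¹).det ^ (-(1:ℝ)/2) *
        (ν1 * s1sq + sysq + θhat ⬝ᵥ ((Q⁻¹ + Ω)⁻¹).mulVec θhat)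
          ^ (-(((n:ℝ) - r2 + ν1) / 2)) /
        (ν0 * s0sq + sysq + θhat ⬝ᵥ Q.mulVec θhat)
          ^ (-(((n:ℝ) - r2 + ν0) / 2))) :
    (ν0 < ν1 →
      Tendsto B10 (comap (fun θhat : EuclideanSpace ℝ (Fin r1) => ‖θhat‖) atTop) (nhds 0)) ∧
    (ν1 < ν0 →
      Tendsto B10 (comap (fun θhat : EuclideanSpace ℝ (Fin r1) => ‖θhat‖) atTop) atTop) := by
  have hS : (Q⁻¹ + Ω).PosDef := hQ.inv.add hΩ
  have hK : 0 < (Ω + Q⁻¹).det ^ (-(1:ℝ)/2) := by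
    apply Real.rpow_pos_of_pos
    rw [add_comm]
    exact hS.det_pos
  obtain ⟨c0, C0, hc0, hC0, h0⟩ := posDef_quad_bounds hr1 Q hQ
  obtain ⟨c1, C1, hc1, hC1, h1⟩ := posDef_quad_bounds hr1 _ hS.inv
  generalize (Ω + Q⁻¹).det ^ (-(1:ℝ)/2) = K at hB10 hK
  have he0 : 0 < ν0 * s0sq + sysq := by positivity
  have he1 : 0 < ν1 * s1sq + sysq := by positivity
  generalize ν0 * s0sq + sysq = e0 at hB10 he0
  generalize ν1 * s1sq + sysq = e1 at hB10 he1
  have ha : 0 < ((n:ℝ) - r2 + ν1) / 2 := by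
    have := min_le_right ν0 ν1
    linarith
  have hb : 0 < ((n:ℝ) - r2 + ν0) / 2 := by
    have := min_le_left ν0 ν1
    linarith
  have hab : ((n:ℝ) - r2 + ν0) / 2 - ((n:ℝ) - r2 + ν1) / 2 = (ν0 - ν1) / 2 := by ring
  generalize ((n:ℝ) - r2 + ν1) / 2 = a at hB10 ha hab
  generalize ((n:ℝ) - r2 + ν0) / 2 = b at hB10 hb hab
  have htend : Tendsto (fun x : EuclideanSpace ℝ (Fin r1) => ‖x‖ ^ 2)
      (comap (fun θhat : EuclideanSpace ℝ (Fin r1) => ‖θhat‖) atTop) atTop :=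
    (tendsto_pow_atTop two_ne_zero).comp tendsto_comap
  have hev : ∀ᶠ x in (comap (fun θhat : EuclideanSpace ℝ (Fin r1) => ‖θhat‖) atTop),
      1 ≤ ‖x‖ ^ 2 := htend.eventually_ge_atTop 1
  have key : ∀ c d t : ℝ, 0 < c → 0 < d → 0 < t →
      K * (c * t) ^ (-a) * (d * t) ^ b = (K * c ^ (-a) * d ^ b) * t ^ ((ν0 - ν1) / 2) := by
    intro c d t hc hd ht
    rw [Real.mul_rpow hc.le ht.le, Real.mul_rpow hd.le ht.le, ← hab, sub_eq_add_neg,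
      Real.rpow_add ht]
    ring
  have hB : ∀ x : EuclideanSpace ℝ (Fin r1), B10 x =
      K * (e1 + x ⬝ᵥ ((Q⁻¹ + Ω)⁻¹).mulVec x) ^ (-a) * (e0 + x ⬝ᵥ Q.mulVec x) ^ b := by
    intro x
    have : 0 ≤ e0 + x ⬝ᵥ Q.mulVec x := by
      have := (h0 x).1
      have : 0 ≤ c0 * ‖x‖ ^ 2 := by positivity
      linarith
    rw [hB10, Real.rpow_neg this, div_inv_eq_mul]
  constructor
  · intro hν
    have hlim : Tendsto (fun x : EuclideanSpace ℝ (Fin r1) =>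
        (K * c1 ^ (-a) * (e0 + C0) ^ b) * (‖x‖ ^ 2) ^ ((ν0 - ν1) / 2))
        (comap (fun θhat : EuclideanSpace ℝ (Fin r1) => ‖θhat‖) atTop) (nhds 0) := by
      have h2 := (tendsto_rpow_neg_atTop (y := (ν1 - ν0) / 2) (by linarith)).comp htend
      have h3 := h2.const_mul (K * c1 ^ (-a) * (e0 + C0) ^ b)
      rw [mul_zero] at h3
      refine h3.congr fun x => ?_
      simp only [Function.comp]
      congr 2
      ring
    refine tendsto_of_tendsto_of_tendsto_of_le_of_le' tendsto_const_nhds hlim ?_ ?_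
    · filter_upwards [hev] with x hx
      rw [hB]
      have := (h0 x).1
      have := (h1 x).1
      have : 0 ≤ c0 * ‖x‖ ^ 2 := by positivity
      have : 0 ≤ c1 * ‖x‖ ^ 2 := by positivity
      exact mul_nonneg (mul_nonneg hK.le (Real.rpow_nonneg (by linarith) _))
        (Real.rpow_nonneg (by linarith) _)
    · filter_upwards [hev] with x hx
      have ht : 0 < ‖x‖ ^ 2 := by linarith
      rw [hB, ← key c1 (e0 + C0) _ hc1 (by linarith) ht]
      obtain ⟨l0, u0⟩ := h0 x
      obtain ⟨l1, u1⟩ := h1 x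
      have p0 : 0 < c0 * ‖x‖ ^ 2 := by positivity
      have p1 : 0 < c1 * ‖x‖ ^ 2 := by positivity
      have i1 := Real.rpow_le_rpow_of_nonpos p1
        (show c1 * ‖x‖ ^ 2 ≤ e1 + x ⬝ᵥ ((Q⁻¹ + Ω)⁻¹).mulVec x by linarith)
        (show -a ≤ 0 by linarith)
      have i0 := Real.rpow_le_rpow (show 0 ≤ e0 + x ⬝ᵥ Q.mulVec x by linarith)
        (show e0 + x ⬝ᵥ Q.mulVec x ≤ (e0 + C0) * ‖x‖ ^ 2 by nlinarith) hb.le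
      exact mul_le_mul (mul_le_mul_of_nonneg_left i1 hK.le) i0
        (Real.rpow_nonneg (by linarith) _)
        (mul_nonneg hK.le (Real.rpow_nonneg p1.le _))
  · intro hν
    have hlim : Tendsto (fun x : EuclideanSpace ℝ (Fin r1) =>
        (K * (e1 + C1) ^ (-a) * c0 ^ b) * (‖x‖ ^ 2) ^ ((ν0 - ν1) / 2))
        (comap (fun θhat : EuclideanSpace ℝ (Fin r1) => ‖θhat‖) atTop) atTop := by
      have h2 := (tendsto_rpow_atTop (y := (ν0 - ν1) / 2) (by linarith)).comp htend
      exact h2.const_mul_atTop (by positivity)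
    refine tendsto_atTop_mono' _ ?_ hlim
    filter_upwards [hev] with x hx
    have ht : 0 < ‖x‖ ^ 2 := by linarith
    rw [hB, ← key (e1 + C1) c0 _ (by linarith) hc0 ht]
    obtain ⟨l0, u0⟩ := h0 x
    obtain ⟨l1, u1⟩ := h1 x
    have p0 : 0 < c0 * ‖x‖ ^ 2 := by positivity
    have p1 : 0 < c1 * ‖x‖ ^ 2 := by positivity
    have i1 := Real.rpow_le_rpow_of_nonpos
      (show 0 < e1 + x ⬝ᵥ ((Q⁻¹ + Ω)⁻¹).mulVec x by linarith)
      (show e1 + x ⬝ᵥ ((Q⁻¹ + Ω)⁻¹).mulVec x ≤ (e1 + C1) * ‖x‖ ^ 2 by nlinarith)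
      (show -a ≤ 0 by linarith)
    have i0 := Real.rpow_le_rpow p0.le
      (show c0 * ‖x‖ ^ 2 ≤ e0 + x ⬝ᵥ Q.mulVec x by linarith) hb.le
    exact mul_le_mul (mul_le_mul_of_nonneg_left i1 hK.le) i0
      (Real.rpow_nonneg p0.le _)
      (mul_nonneg hK.le (Real.rpow_nonneg (by linarith) _))
end

section
/- For the univariate t-test with equicorrelated data described below, the conjugate-prior Bayes factor can be written as a function of the t-statistic: B10 = (1 + n/(1 + (n−1)ρ))^{−1/2} · (1 − n t² / ((t² + n − 1)(n + 1 + (n−1)ρ)))^{−n/2}. -/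
open MeasureTheory Filter

/-- For the univariate t-test with equicorrelated data, the conjugate-prior
Bayes factor can be written as a function of the t-statistic:
B10 = (1 + n/(1+(n−1)ρ))^{−1/2} (1 − n t² / ((t²+n−1)(n+1+(n−1)ρ)))^{−n/2}. -/
theorem univariate_ttest_bayes_factor_as_function_of_t
    (n : ℕ) (hn : 2 ≤ n) (ρ : ℝ) (hρl : -(1 / ((n:ℝ) - 1)) < ρ) (hρu : ρ < 1)
    (sysq : ℝ) (hsy : 0 < sysq) (θhat : ℝ)
    (a : ℝ) (ha : a = (n:ℝ) / (1 + ((n:ℝ) - 1) * ρ))   -- a = 1ₙᵀΣ⁻¹1ₙ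
    (t : ℝ) (ht : t = θhat * Real.sqrt a / (Real.sqrt sysq / Real.sqrt ((n:ℝ) - 1)))
    (B10 : ℝ) (hB10 : B10 = (1 + a) ^ (-(1:ℝ)/2) *
        (sysq + θhat ^ 2 * a / (1 + a)) ^ (-(n:ℝ)/2) /
        (sysq + θhat ^ 2 * a) ^ (-(n:ℝ)/2)) :
    B10 = (1 + (n:ℝ) / (1 + ((n:ℝ) - 1) * ρ)) ^ (-(1:ℝ)/2) *
      (1 - (n:ℝ) * t ^ 2 / ((t ^ 2 + (n:ℝ) - 1) * ((n:ℝ) + 1 + ((n:ℝ) - 1) * ρ)))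
        ^ (-(n:ℝ)/2) := by
  have hn' : (2:ℝ) ≤ n := by exact_mod_cast hn
  have hm : 0 < (n:ℝ) - 1 := by linarith
  have hD : 0 < 1 + ((n:ℝ) - 1) * ρ := by
    have h := mul_lt_mul_of_pos_left hρl hm
    have h2 : ((n:ℝ) - 1) * -(1 / ((n:ℝ) - 1)) = -1 := by field_simp
    linarith
  have hapos : 0 < a := by rw [ha]; positivity
  have ht2 : t ^ 2 = θhat ^ 2 * a * ((n:ℝ) - 1) / sysq := by
    rw [ht, div_pow, div_pow, mul_pow, Real.sq_sqrt hapos.le, Real.sq_sqrt hsy.le,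
      Real.sq_sqrt hm.le]
    field_simp
  have hQ : 0 ≤ θhat ^ 2 * a := by positivity
  have hS : 0 < sysq + θhat ^ 2 * a := by linarith
  have hnD : (n:ℝ) = a * (1 + ((n:ℝ) - 1) * ρ) := by rw [ha]; field_simp
  have hE : (n:ℝ) + 1 + ((n:ℝ) - 1) * ρ = (1 + ((n:ℝ) - 1) * ρ) * (1 + a) := by
    linear_combination hnD
  have hT : t ^ 2 + (n:ℝ) - 1 = ((n:ℝ) - 1) * (sysq + θhat ^ 2 * a) / sysq := by
    rw [ht2]; field_simp; ring
  have key : 1 - (n:ℝ) * t ^ 2 / ((t ^ 2 + (n:ℝ) - 1) * ((n:ℝ) + 1 + ((n:ℝ) - 1) * ρ))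
      = (sysq + θhat ^ 2 * a / (1 + a)) / (sysq + θhat ^ 2 * a) := by
    rw [hE, hT, ht2]
    generalize (1 + ((n:ℝ) - 1) * ρ) = D at *
    have h1a : 0 < 1 + a := by linarith
    generalize (n:ℝ) - 1 = m at *
    rw [hnD]
    field_simp
    ring
  rw [key, Real.div_rpow (by positivity) hS.le, hB10, ← ha, mul_div_assoc]
end

section
/- For the univariate t-test with equicorrelated data, the Bayes factor B10(t) = (1 + n/(1 + (n−1)ρ))^{−1/2}(1 − n t²/((t² + n − 1)(n + 1 + (n−1)ρ)))^{−n/2} converges, as |t| → ∞, to (1 + n/(1 + (n−1)ρ))^{−1/2}(1 − n/(n + 1 + (n−1)ρ))^{−n/2}; in particular this limit equals (1+n)^{(n−1)/2} when ρ = 0 and equals 2^{(n−1)/2} when ρ = 1. -/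
open MeasureTheory Filter

/-- The univariate-t-test Bayes factor B10(t) converges, as |t| → ∞, to
(1 + n/(1+(n−1)ρ))^{−1/2}(1 − n/(n+1+(n−1)ρ))^{−n/2}; this limit equals (1+n)^{(n−1)/2}
when ρ = 0 and 2^{(n−1)/2} when ρ = 1. -/
theorem univariate_ttest_bayes_factor_limit
    (n : ℕ) (hn : 2 ≤ n) (ρ : ℝ) (hρl : -(1 / ((n:ℝ) - 1)) < ρ) (hρu : ρ ≤ 1)
    (B10 : ℝ → ℝ)
    (hB10 : ∀ t : ℝ, B10 t = (1 + (n:ℝ) / (1 + ((n:ℝ) - 1) * ρ)) ^ (-(1:ℝ)/2) *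
      (1 - (n:ℝ) * t ^ 2 / ((t ^ 2 + (n:ℝ) - 1) * ((n:ℝ) + 1 + ((n:ℝ) - 1) * ρ)))
        ^ (-(n:ℝ)/2))
    (L : ℝ) (hL : L = (1 + (n:ℝ) / (1 + ((n:ℝ) - 1) * ρ)) ^ (-(1:ℝ)/2) *
      (1 - (n:ℝ) / ((n:ℝ) + 1 + ((n:ℝ) - 1) * ρ)) ^ (-(n:ℝ)/2)) :
    Tendsto B10 (comap (fun t : ℝ => |t|) atTop) (nhds L) ∧
    (ρ = 0 → L = (1 + (n:ℝ)) ^ (((n:ℝ) - 1) / 2)) ∧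
    (ρ = 1 → L = 2 ^ (((n:ℝ) - 1) / 2)) := by
  have hn' : (2:ℝ) ≤ n := by exact_mod_cast hn
  have hn1 : (0:ℝ) < (n:ℝ) - 1 := by linarith
  have hA : 0 < 1 + ((n:ℝ) - 1) * ρ := by
    have h := mul_lt_mul_of_pos_left hρl hn1
    have h2 : ((n:ℝ) - 1) * -(1 / ((n:ℝ) - 1)) = -1 := by field_simp
    linarith
  have hD : 0 < (n:ℝ) + 1 + ((n:ℝ) - 1) * ρ := by linarith
  have hpos : 0 < 1 - (n:ℝ) / ((n:ℝ) + 1 + ((n:ℝ) - 1) * ρ) := by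
    rw [sub_pos, div_lt_one hD]; linarith
  have key : ∀ a : ℝ, 0 < a →
      a ^ (-(1:ℝ)/2) * (1 / a) ^ (-(n:ℝ)/2) = a ^ (((n:ℝ) - 1) / 2) := by
    intro a ha
    rw [one_div, Real.inv_rpow ha.le, ← Real.rpow_neg ha.le, ← Real.rpow_add ha]
    congr 1; ring
  refine ⟨?_, ?_, ?_⟩
  · rw [hL, show B10 = _ from funext hB10]
    refine Tendsto.const_mul _ (Tendsto.rpow_const ?_ (Or.inl hpos.ne'))
    refine Tendsto.const_sub _ ?_
    have habs : Tendsto (fun t : ℝ => |t|) (comap (fun t : ℝ => |t|) atTop) atTop :=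
      tendsto_comap
    have hsq : Tendsto (fun t : ℝ => t ^ 2 + ((n:ℝ) - 1))
        (comap (fun t : ℝ => |t|) atTop) atTop := by
      refine tendsto_atTop_add_const_right _ _ ?_
      have h := (tendsto_pow_atTop (α := ℝ) (n := 2) two_ne_zero).comp habs
      refine h.congr (fun t => ?_)
      simp
    have h0 := hsq.inv_tendsto_atTop
    have h1 := ((h0.const_mul ((n:ℝ) - 1)).const_sub 1).const_mul
      ((n:ℝ) / ((n:ℝ) + 1 + ((n:ℝ) - 1) * ρ))
    rw [mul_zero, sub_zero, mul_one] at h1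
    refine h1.congr (fun t => ?_)
    have ht : t ^ 2 + ((n:ℝ) - 1) ≠ 0 := by positivity
    have e : 1 - ((n:ℝ) - 1) * (t ^ 2 + ((n:ℝ) - 1))⁻¹ = t ^ 2 / (t ^ 2 + ((n:ℝ) - 1)) := by
      rw [eq_div_iff ht, sub_mul, mul_assoc, inv_mul_cancel₀ ht]; ring
    simp only [Pi.inv_apply]
    rw [e, div_mul_div_comm, add_sub_assoc,
      mul_comm ((n:ℝ) + 1 + ((n:ℝ) - 1) * ρ)]
  · rintro rfl
    rw [hL, ← key _ (by linarith)]
    congr 2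
    · simp
    · rw [mul_zero, add_zero]; field_simp; ring
  · rintro rfl
    rw [hL, ← key _ two_pos]
    congr 2
    · rw [mul_one, add_sub_cancel, div_self (by linarith)]; norm_num
    · rw [mul_one, show (n:ℝ) + 1 + (n - 1) = 2 * n by ring]; field_simp; ring
end

section
/- Let h(g) = |gΩ + Q⁻¹|^{−1/2} [SSE1 + θ̂ᵀ(gΩ + Q⁻¹)⁻¹θ̂]^{−(n−p1)/2} for g > 0. Then there exist constants 0 < d_l < d_u < ∞ (the smallest and largest eigenvalues of Ω^{−1/2}Q⁻¹Ω^{−1/2}) and positive constants, none depending on g or θ̂, such that (g + d_l)^{(n−p1−r1)/2} / [(g + d_l)·SSE1 + θ̂ᵀΩ⁻¹θ̂]^{(n−p1)/2} ≲ h(g) ≲ (g + d_u)^{(n−p1−r1)/2} / [(g + d_u)·SSE1 + θ̂ᵀΩ⁻¹θ̂]^{(n−p1)/2}, where ≲ denotes inequality up to a positive multiplicative constant independent of g and θ̂. -/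
open MeasureTheory Filter Matrix

lemma aux_spec {r : ℕ} {A : Matrix (Fin r) (Fin r) ℝ} (hA : A.PosDef) :
    ∃ (U : Matrix (Fin r) (Fin r) ℝ) (d : Fin r → ℝ), (∀ i, 0 < d i) ∧ Uᵀ * U = 1 ∧
      A = U * diagonal d * Uᵀ := by
  refine ⟨hA.1.eigenvectorUnitary, hA.1.eigenvalues, hA.eigenvalues_pos, ?_, ?_⟩
  · have := Unitary.coe_star_mul_self hA.1.eigenvectorUnitary
    simpa [star_eq_conjTranspose, conjTranspose_eq_transpose_of_trivial] using this
  · have := hA.1.spectral_theorem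
    rw [Unitary.conjStarAlgAut_apply] at this
    simpa [star_eq_conjTranspose, conjTranspose_eq_transpose_of_trivial, Function.comp_def] using this

lemma aux_simdiag {r : ℕ} {A B : Matrix (Fin r) (Fin r) ℝ} (hA : A.PosDef) (hB : B.PosDef) :
    ∃ (C : Matrix (Fin r) (Fin r) ℝ) (d : Fin r → ℝ), (∀ i, 0 < d i) ∧ IsUnit C.det ∧
      A = Cᵀ * C ∧ B = Cᵀ * diagonal d * C := by
  obtain ⟨U, e, he, hU, hAe⟩ := aux_spec hA
  set S : Matrix (Fin r) (Fin r) ℝ := diagonal (fun i => √(e i)) * Uᵀ with hS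
  have hAS : A = Sᵀ * S := by
    rw [hAe, hS, transpose_mul, transpose_transpose, diagonal_transpose]
    rw [Matrix.mul_assoc, Matrix.mul_assoc, ← Matrix.mul_assoc (diagonal _) (diagonal _),
      diagonal_mul_diagonal]
    simp [Real.mul_self_sqrt (he _).le]
  have hSdet : IsUnit S.det := by
    have h1 := hA.det_pos
    rw [hAS, det_mul, det_transpose] at h1
    rw [isUnit_iff_ne_zero]
    rintro h0
    simp [h0] at h1
  have hT : (S⁻¹ᴴ * B * S⁻¹).PosDef := by
    apply hB.conjTranspose_mul_mul_same
    apply Matrix.mulVec_injective_of_isUnit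
    rw [Matrix.isUnit_iff_isUnit_det]
    exact Matrix.isUnit_nonsing_inv_det _ hSdet
  obtain ⟨V, d, hd, hV, hBd⟩ := aux_spec hT
  have hV' : V * Vᵀ = 1 := mul_eq_one_comm.mp hV
  refine ⟨Vᵀ * S, d, hd, ?_, ?_, ?_⟩
  · rw [det_mul]
    refine IsUnit.mul ?_ hSdet
    have := congrArg det hV
    rw [det_mul, det_one] at this
    exact IsUnit.of_mul_eq_one _ this
  · rw [transpose_mul, transpose_transpose, Matrix.mul_assoc, ← Matrix.mul_assoc V, hV',
      Matrix.one_mul, hAS]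
  · have : Sᵀ * (S⁻¹ᴴ * B * S⁻¹) * S = B := by
      rw [conjTranspose_eq_transpose_of_trivial]
      have h2 : Sᵀ * S⁻¹ᵀ = 1 := by
        rw [← transpose_mul, nonsing_inv_mul _ hSdet, transpose_one]
      calc _ = (Sᵀ * S⁻¹ᵀ) * B * (S⁻¹ * S) := by simp only [Matrix.mul_assoc]
        _ = B := by rw [h2, nonsing_inv_mul _ hSdet]; simp
    rw [← this, hBd, transpose_mul Vᵀ S, transpose_transpose]
    simp only [Matrix.mul_assoc]

/-- quadratic form of the inverse -/
lemma aux_inv {r : ℕ} {C : Matrix (Fin r) (Fin r) ℝ} (hC : IsUnit C.det) (e : Fin r → ℝ)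
    (he : ∀ i, 0 < e i) (x : Fin r → ℝ) :
    x ⬝ᵥ ((Cᵀ * diagonal e * C)⁻¹).mulVec x = ∑ i, ((C⁻¹ᵀ *ᵥ x) i) ^ 2 / e i := by
  have hinv : (Cᵀ * diagonal e * C)⁻¹ = C⁻¹ * diagonal (fun i => (e i)⁻¹) * C⁻¹ᵀ := by
    apply inv_eq_right_inv
    have h2 : Cᵀ * C⁻¹ᵀ = 1 := by
      rw [← transpose_mul, nonsing_inv_mul _ hC, transpose_one]
    have h3 : diagonal e * diagonal (fun i => (e i)⁻¹) = 1 := by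
      rw [diagonal_mul_diagonal]
      simp [fun i => mul_inv_cancel₀ (he i).ne']
    calc _ = Cᵀ * (diagonal e * (C * C⁻¹) * diagonal (fun i => (e i)⁻¹)) * C⁻¹ᵀ := by
          simp only [Matrix.mul_assoc]
      _ = 1 := by rw [mul_nonsing_inv _ hC, Matrix.mul_one, h3, Matrix.mul_one, h2]
  rw [hinv, ← mulVec_mulVec, ← mulVec_mulVec, dotProduct_mulVec, ← mulVec_transpose]
  simp only [dotProduct, mulVec_diagonal]
  refine Finset.sum_congr rfl fun i _ => ?_
  rw [div_eq_mul_inv]; ring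

lemma aux_scalar {dl du s D q w D0 k : ℝ} {r : ℕ} {g : ℝ} (hdl : 0 < dl) (hdu : dl < du) (hg : 0 < g)
    (hs : 0 < s) (hk : 0 < k) (hq : 0 ≤ q) (hD0 : 0 < D0)
    (hD1 : D0 * (g + dl) ^ r ≤ D) (hD2 : D ≤ D0 * (g + du) ^ r)
    (hw1 : q / (g + du) ≤ w) (hw2 : w ≤ q / (g + dl)) :
    (D0 ^ (-(1:ℝ)/2) * (dl / du) ^ ((r:ℝ)/2)) * ((g + dl) ^ ((k - r) / 2) /
      ((g + dl) * s + q) ^ (k / 2)) ≤ D ^ (-(1:ℝ)/2) * (s + w) ^ (-(k/2)) ∧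
    D ^ (-(1:ℝ)/2) * (s + w) ^ (-(k/2)) ≤ (D0 ^ (-(1:ℝ)/2) * (du / dl) ^ ((r:ℝ)/2)) *
      ((g + du) ^ ((k - r) / 2) / ((g + du) * s + q) ^ (k / 2)) := by
  have hdu0 : 0 < du := hdl.trans hdu
  have ha : 0 < g + dl := by linarith
  have hb : 0 < g + du := by linarith
  have key : ∀ t, 0 < t → ∀ c, 0 < c → (D0 ^ (-(1:ℝ)/2) * c ^ ((r:ℝ)/2)) * (t ^ ((k - r) / 2) /
      (t * s + q) ^ (k / 2)) = (D0 * (t / c) ^ r) ^ (-(1:ℝ)/2) * (s + q / t) ^ (-(k/2)) := by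
    intro t ht c hc
    have e1 : s + q / t = (t * s + q) / t := by field_simp
    have hp : 0 < t * s + q := by positivity
    rw [e1, Real.mul_rpow hD0.le (by positivity), ← Real.rpow_natCast (t / c), ← Real.rpow_mul (by positivity),
      Real.div_rpow ht.le hc.le, Real.div_rpow hp.le ht.le, Real.rpow_neg hp.le, Real.rpow_neg ht.le,
      show (r:ℝ) * (-1/2) = -((r:ℝ)/2) by ring, Real.rpow_neg ht.le, Real.rpow_neg hc.le,
      show (k - r)/2 = k/2 - (r:ℝ)/2 by ring, Real.rpow_sub ht]
    field_simp
  have hw0 : 0 ≤ w := le_trans (by positivity) hw1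
  have hD : 0 < D := lt_of_lt_of_le (by positivity) hD1
  constructor
  · rw [key _ ha _ (by positivity)]
    apply mul_le_mul
    · apply Real.rpow_le_rpow_of_nonpos hD _ (by norm_num)
      refine hD2.trans ?_
      gcongr
      rw [le_div_iff₀ (by positivity), mul_div_assoc', div_le_iff₀ hdu0]
      nlinarith
    · apply Real.rpow_le_rpow_of_nonpos (by positivity) _ (by linarith)
      linarith
    · positivity
    · positivity
  · rw [key _ hb _ (by positivity)]
    apply mul_le_mul
    · apply Real.rpow_le_rpow_of_nonpos (by positivity) _ (by norm_num)
      refine le_trans ?_ hD1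
      gcongr
      rw [div_le_iff₀ (by positivity), mul_div_assoc', le_div_iff₀ hdl]
      nlinarith
    · apply Real.rpow_le_rpow_of_nonpos (by positivity) _ (by linarith)
      linarith
    · positivity
    · positivity


/-- Two-sided bound for h(g) = |gΩ + Q⁻¹|^{−1/2}[SSE1 + θ̂ᵀ(gΩ+Q⁻¹)⁻¹θ̂]^{−(n−p1)/2}:
there exist 0 < d_l < d_u and positive constants, none depending on g or θ̂, such that
(g+d_l)^{(n−p1−r1)/2}/[(g+d_l)SSE1 + θ̂ᵀΩ⁻¹θ̂]^{(n−p1)/2} ≲ h(g) ≲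
(g+d_u)^{(n−p1−r1)/2}/[(g+d_u)SSE1 + θ̂ᵀΩ⁻¹θ̂]^{(n−p1)/2}. -/
theorem mixture_kernel_two_sided_bound
    (n r1 r2 : ℕ) (hn : 1 ≤ n) (hr1 : 1 ≤ r1)
    (Q Ω : Matrix (Fin r1) (Fin r1) ℝ) (hQ : Q.PosDef) (hΩ : Ω.PosDef)
    (ν1 : ℝ) (hν1 : 0 ≤ ν1) (hdf : 0 < (n : ℝ) - r2 + ν1)
    (s1sq : ℝ) (hs1 : 0 < s1sq) (sysq : ℝ) (hsy : 0 < sysq)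
    (SSE1 : ℝ) (hSSE1 : SSE1 = ν1 * s1sq + sysq)
    (h : ℝ → EuclideanSpace ℝ (Fin r1) → ℝ)
    (hh : ∀ (g : ℝ) (θhat : EuclideanSpace ℝ (Fin r1)),
      h g θhat = (g • Ω + Q⁻¹).det ^ (-(1:ℝ)/2) *
        (SSE1 + θhat ⬝ᵥ ((g • Ω + Q⁻¹)⁻¹).mulVec θhat)
          ^ (-(((n:ℝ) - r2 + ν1) / 2))) :
    ∃ dl du cl cu : ℝ, 0 < dl ∧ dl < du ∧ 0 < cl ∧ 0 < cu ∧
      ∀ (g : ℝ), 0 < g → ∀ (θhat : EuclideanSpace ℝ (Fin r1)),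
        cl * ((g + dl) ^ (((n:ℝ) - r2 + ν1 - r1) / 2) /
            ((g + dl) * SSE1 + θhat ⬝ᵥ (Ω⁻¹).mulVec θhat)
              ^ (((n:ℝ) - r2 + ν1) / 2)) ≤ h g θhat ∧
        h g θhat ≤ cu * ((g + du) ^ (((n:ℝ) - r2 + ν1 - r1) / 2) /
            ((g + du) * SSE1 + θhat ⬝ᵥ (Ω⁻¹).mulVec θhat)
              ^ (((n:ℝ) - r2 + ν1) / 2)) := by
  obtain ⟨C, d, hd, hC, hΩC, hQC⟩ := aux_simdiag hΩ hQ.inv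
  have : Nonempty (Fin r1) := ⟨⟨0, hr1⟩⟩
  obtain ⟨i0, hi0⟩ := Finite.exists_min d
  obtain ⟨i1, hi1⟩ := Finite.exists_max d
  have hdl := hd i0
  have hlu : d i0 < d i1 + 1 := by linarith [hi0 i1]
  have hs : 0 < SSE1 := by rw [hSSE1]; positivity
  refine ⟨d i0, d i1 + 1, Ω.det ^ (-(1:ℝ)/2) * (d i0 / (d i1 + 1)) ^ ((r1:ℝ)/2),
    Ω.det ^ (-(1:ℝ)/2) * ((d i1 + 1) / d i0) ^ ((r1:ℝ)/2), hdl, hlu, ?_, ?_, ?_⟩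
  · have := hΩ.det_pos
    have := hd i1
    positivity
  · have := hΩ.det_pos
    have := hd i1
    positivity
  intro g hg θ
  rw [hh]
  have hM : g • Ω + Q⁻¹ = Cᵀ * diagonal (fun i => g + d i) * C := by
    rw [hQC, hΩC]
    have : diagonal (fun i => g + d i) = g • (1 : Matrix (Fin r1) (Fin r1) ℝ) + diagonal d := by
      rw [smul_one_eq_diagonal, diagonal_add]
    rw [this, Matrix.mul_add, Matrix.add_mul]
    simp
  have hΩ1 : Ω = Cᵀ * diagonal (fun _ => 1) * C := by
    rw [diagonal_one, Matrix.mul_one, hΩC]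
  have hq : (θ : Fin r1 → ℝ) ⬝ᵥ (Ω⁻¹).mulVec θ = ∑ i, ((C⁻¹ᵀ *ᵥ (θ : Fin r1 → ℝ)) i) ^ 2 := by
    rw [hΩ1, aux_inv hC _ (fun _ => one_pos)]
    simp
  have hw := aux_inv hC (fun i => g + d i) (fun i => add_pos hg (hd i)) θ
  have hdet : (g • Ω + Q⁻¹).det = Ω.det * ∏ i, (g + d i) := by
    rw [hM, hΩC, det_mul, det_mul, det_mul, det_diagonal]
    ring
  apply aux_scalar hdl hlu hg hs hdf
  · rw [hq]; positivity
  · exact hΩ.det_pos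
  · rw [hdet]
    refine mul_le_mul_of_nonneg_left ?_ hΩ.det_pos.le
    calc (g + d i0) ^ r1 = ∏ i : Fin r1, (g + d i0) := by simp
      _ ≤ _ := Finset.prod_le_prod (fun i _ => by positivity) (fun i _ => by linarith [hi0 i])
  · rw [hdet]
    refine mul_le_mul_of_nonneg_left ?_ hΩ.det_pos.le
    calc _ ≤ ∏ i : Fin r1, (g + (d i1 + 1)) :=
          Finset.prod_le_prod (fun i _ => by linarith [hd i]) (fun i _ => by linarith [hi1 i])
      _ = _ := by simp
  · rw [hM, hw, hq, Finset.sum_div]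
    refine Finset.sum_le_sum fun i _ => ?_
    exact div_le_div_of_nonneg_left (sq_nonneg _) (by linarith [hd i]) (by linarith [hi1 i])
  · rw [hM, hw, hq, Finset.sum_div]
    refine Finset.sum_le_sum fun i _ => ?_
    exact div_le_div_of_nonneg_left (sq_nonneg _) (by linarith) (by linarith [hi0 i])
end

section
/- Consider the scale-mixture Bayes factor B10^mix(θ̂) defined below with ν0 > ν1. Then for any prior density π on (0, ∞) with positive support, B10^mix(θ̂) → ∞ as |θ̂| → ∞ (information consistency). -/
open MeasureTheory Filter Matrix

namespace MixBF

/-- Quadratic form comparison between the mixture precision and `Q`. -/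
lemma quad_le {r : ℕ} {Q Ω : Matrix (Fin r) (Fin r) ℝ} (hQ : Q.PosDef) (hΩ : Ω.PosDef)
    {g : ℝ} (hg : 0 < g) (x : Fin r → ℝ) :
    x ⬝ᵥ ((g • Ω + Q⁻¹)⁻¹).mulVec x ≤ x ⬝ᵥ Q.mulVec x := by
  have hP : Q⁻¹.PosDef := hQ.inv
  have hA : (g • Ω + Q⁻¹).PosDef := (hΩ.smul hg).add hP
  have hAu : IsUnit (g • Ω + Q⁻¹).det := hA.det_pos.ne'.isUnit
  have hQu : IsUnit Q.det := hQ.det_pos.ne'.isUnit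
  set u := (g • Ω + Q⁻¹)⁻¹.mulVec x with hu
  set v := Q.mulVec x with hv
  have h1 : (g • Ω + Q⁻¹).mulVec u = x := by
    rw [hu, mulVec_mulVec, mul_nonsing_inv _ hAu, one_mulVec]
  have h2 : Q⁻¹.mulVec v = x := by
    rw [hv, mulVec_mulVec, nonsing_inv_mul _ hQu, one_mulVec]
  have h3 : 0 ≤ (u - v) ⬝ᵥ Q⁻¹.mulVec (u - v) := by
    simpa using hP.posSemidef.dotProduct_mulVec_nonneg (u - v)
  have h4 : 0 ≤ u ⬝ᵥ Ω.mulVec u := by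
    simpa using hΩ.posSemidef.dotProduct_mulVec_nonneg u
  have h5 : g * (u ⬝ᵥ Ω.mulVec u) + u ⬝ᵥ Q⁻¹.mulVec u = u ⬝ᵥ x := by
    conv_rhs => rw [← h1]
    rw [add_mulVec, dotProduct_add, smul_mulVec, dotProduct_smul, smul_eq_mul]
  have hsym : Q⁻¹ᵀ = Q⁻¹ := by
    have := hP.isHermitian.eq
    rwa [conjTranspose_eq_transpose_of_trivial] at this
  have h6 : v ⬝ᵥ Q⁻¹.mulVec u = u ⬝ᵥ x := by
    rw [dotProduct_mulVec, ← mulVec_transpose, hsym, h2, dotProduct_comm]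
  rw [mulVec_sub, h2, sub_dotProduct, dotProduct_sub, dotProduct_sub, h6] at h3
  rw [dotProduct_comm x u, dotProduct_comm x v]
  have := mul_nonneg hg.le h4
  linarith

/-- Coercivity of a positive definite form. -/
lemma quad_coercive {r : ℕ} {Q : Matrix (Fin r) (Fin r) ℝ} (hQ : Q.PosDef) :
    ∃ c > 0, ∀ x : EuclideanSpace ℝ (Fin r), c * ‖x‖ ^ 2 ≤ x ⬝ᵥ Q.mulVec x := by
  have hcont : Continuous fun x : EuclideanSpace ℝ (Fin r) => (x : Fin r → ℝ) ⬝ᵥ Q.mulVec x := by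
    unfold dotProduct mulVec dotProduct
    fun_prop
  have hpos : ∀ x : EuclideanSpace ℝ (Fin r), x ≠ 0 → 0 < (x : Fin r → ℝ) ⬝ᵥ Q.mulVec x := by
    intro x hx
    have hx' : (x : Fin r → ℝ) ≠ 0 := by
      intro h; apply hx; ext i; exact congrFun h i
    simpa using hQ.dotProduct_mulVec_pos hx'
  rcases (Metric.sphere (0 : EuclideanSpace ℝ (Fin r)) 1).eq_empty_or_nonempty with he | hne
  · refine ⟨1, one_pos, fun x => ?_⟩
    by_cases hx : x = 0
    · subst hx; simp
    · exfalso
      have : (‖x‖⁻¹ • x) ∈ Metric.sphere (0 : EuclideanSpace ℝ (Fin r)) 1 := by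
        simp [norm_smul, hx]
      rw [he] at this; exact this
  · obtain ⟨m, hm, hmin⟩ := (isCompact_sphere (0 : EuclideanSpace ℝ (Fin r)) 1).exists_isMinOn
      hne hcont.continuousOn
    have hm0 : m ≠ 0 := by
      rintro rfl; simp at hm
    refine ⟨_, hpos m hm0, fun x => ?_⟩
    by_cases hx : x = 0
    · subst hx; simp
    · have hmem : (‖x‖⁻¹ • x) ∈ Metric.sphere (0 : EuclideanSpace ℝ (Fin r)) 1 := by
        simp [norm_smul, hx]
      have h := hmin hmem
      have hn : 0 < ‖x‖ := norm_pos_iff.mpr hx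
      simp only [Set.mem_setOf_eq, PiLp.smul_apply, WithLp.ofLp_smul, mulVec_smul, dotProduct_smul,
        smul_dotProduct, smul_eq_mul] at h
      have h' := mul_le_mul_of_nonneg_right h (sq_nonneg ‖x‖)
      refine h'.trans (le_of_eq ?_)
      field_simp

lemma det_lower {r : ℕ} {P Ω : Matrix (Fin r) (Fin r) ℝ} (hP : P.PosDef) (hΩ : Ω.PosDef) :
    ∃ d > 0, ∀ g : ℝ, 0 < g → d ≤ (g • Ω + P).det := by
  have key : ∀ A B : Matrix (Fin r) (Fin r) ℝ, A.PosDef → B.PosDef →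
      ∃ d > 0, ∀ t ∈ Set.Icc (0:ℝ) 1, d ≤ (t • A + B).det := by
    intro A B hA hB
    have hc : Continuous fun t : ℝ => (t • A + B).det := by fun_prop
    obtain ⟨m, hm, hmin⟩ := (isCompact_Icc (a := (0:ℝ)) (b := 1)).exists_isMinOn
      ⟨0, by simp⟩ hc.continuousOn
    refine ⟨_, ?_, fun t ht => hmin ht⟩
    exact (PosDef.posSemidef_add (hA.posSemidef.smul hm.1) hB).det_pos
  obtain ⟨d1, hd1, h1⟩ := key Ω P hΩ hP
  obtain ⟨d2, hd2, h2⟩ := key P Ω hP hΩ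
  refine ⟨min d1 d2, lt_min hd1 hd2, fun g hg => ?_⟩
  rcases le_total g 1 with h | h
  · exact (min_le_left _ _).trans (h1 g ⟨hg.le, h⟩)
  · have e : g • Ω + P = g • (g⁻¹ • P + Ω) := by
      rw [smul_add, smul_smul, mul_inv_cancel₀ hg.ne', one_smul, add_comm]
    have h3 := h2 g⁻¹ ⟨by positivity, inv_le_one_of_one_le₀ h⟩
    rw [e, det_smul]
    have h4 : 1 ≤ g ^ Fintype.card (Fin r) := one_le_pow₀ h
    refine (min_le_right _ _).trans (h3.trans ?_)
    exact le_mul_of_one_le_left (hd2.le.trans h3) h4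

end MixBF

/-- For the scale-mixture Bayes factor with ν0 > ν1, any mixing prior with
positive support yields an information-consistent Bayes factor: B10^mix → ∞ as |θ̂| → ∞. -/
theorem mixture_bayes_factor_consistent_of_nu0_gt_nu1
    (n r1 r2 : ℕ) (hn : 1 ≤ n) (hr1 : 1 ≤ r1)
    (Q Ω : Matrix (Fin r1) (Fin r1) ℝ) (hQ : Q.PosDef) (hΩ : Ω.PosDef)
    (ν0 ν1 : ℝ) (hν0 : 0 ≤ ν0) (hν1 : 0 ≤ ν1)
    (hdf : 0 < (n : ℝ) - r1 - r2 + ν1)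
    (s0sq s1sq : ℝ) (hs0 : 0 < s0sq) (hs1 : 0 < s1sq)
    (sysq : ℝ) (hsy : 0 < sysq)
    (pri : ℝ → ℝ) (hpri_meas : Measurable pri)
    (hpri_nonneg : ∀ g ∈ Set.Ioi (0:ℝ), 0 ≤ pri g)
    (hpri_int : ∫ g in Set.Ioi (0:ℝ), pri g = 1)
    (Bmix : EuclideanSpace ℝ (Fin r1) → ℝ)
    (hBmix : ∀ θhat : EuclideanSpace ℝ (Fin r1),
      Bmix θhat =
        (∫ g in Set.Ioi (0:ℝ),
          (g • Ω + Q⁻¹).det ^ (-(1:ℝ)/2) *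
            (ν1 * s1sq + sysq + θhat ⬝ᵥ ((g • Ω + Q⁻¹)⁻¹).mulVec θhat)
              ^ (-(((n:ℝ) - r2 + ν1) / 2)) * pri g) /
        (ν0 * s0sq + sysq + θhat ⬝ᵥ Q.mulVec θhat)
          ^ (-(((n:ℝ) - r2 + ν0) / 2)))
    (hν : ν1 < ν0)
    (hpri_pos : ∀ g ∈ Set.Ioi (0:ℝ), 0 < pri g) :
    Tendsto Bmix (comap (fun θhat : EuclideanSpace ℝ (Fin r1) => ‖θhat‖) atTop) atTop := by
  have hpint : IntegrableOn pri (Set.Ioi (0:ℝ)) := by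
    by_contra h
    rw [integral_undef h] at hpri_int
    exact zero_ne_one hpri_int
  have hP : Q⁻¹.PosDef := hQ.inv
  have hA : ∀ g : ℝ, 0 < g → (g • Ω + Q⁻¹).PosDef := fun g hg => (hΩ.smul hg).add hP
  obtain ⟨d, hd, hdet⟩ := MixBF.det_lower hP hΩ
  obtain ⟨c, hc, hcoer⟩ := MixBF.quad_coercive hQ
  have hr1' : (1:ℝ) ≤ r1 := by exact_mod_cast hr1
  set a1 : ℝ := ((n:ℝ) - r2 + ν1) / 2 with ha1
  set a0 : ℝ := ((n:ℝ) - r2 + ν0) / 2 with ha0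
  have ha1pos : 0 < a1 := by rw [ha1]; linarith
  have ha01 : 0 < a0 - a1 := by rw [ha0, ha1]; linarith
  have ha0pos : 0 < a0 := by linarith
  set S1 : ℝ := ν1 * s1sq + sysq with hS1
  set S0 : ℝ := ν0 * s0sq + sysq with hS0
  have hS1p : 0 < S1 := by positivity
  have hS0p : 0 < S0 := by positivity
  have hdm : Measurable fun g : ℝ => (g • Ω + Q⁻¹).det := by
    have : Continuous fun g : ℝ => (g • Ω + Q⁻¹).det := by fun_prop
    exact this.measurable
  have hdb : ∀ g : ℝ, 0 < g → (g • Ω + Q⁻¹).det ^ (-(1:ℝ)/2) ≤ d ^ (-(1:ℝ)/2) := fun g hg =>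
    Real.rpow_le_rpow_of_nonpos hd (hdet g hg) (by norm_num)
  have hdp : ∀ g : ℝ, 0 < g → 0 < (g • Ω + Q⁻¹).det ^ (-(1:ℝ)/2) := fun g hg =>
    Real.rpow_pos_of_pos (hA g hg).det_pos _
  have hint0 : IntegrableOn (fun g : ℝ => (g • Ω + Q⁻¹).det ^ (-(1:ℝ)/2) * pri g)
      (Set.Ioi (0:ℝ)) := by
    refine Integrable.bdd_mul (c := d ^ (-(1:ℝ)/2)) hpint
      (hdm.pow_const _).aestronglyMeasurable ?_
    refine (ae_restrict_iff' measurableSet_Ioi).2 (Eventually.of_forall fun g hg => ?_)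
    rw [Real.norm_of_nonneg (hdp g hg).le]
    exact hdb g hg
  set C : ℝ := ∫ g in Set.Ioi (0:ℝ), (g • Ω + Q⁻¹).det ^ (-(1:ℝ)/2) * pri g with hC
  have hCpos : 0 < C := by
    rw [hC, setIntegral_pos_iff_support_of_nonneg_ae _ hint0]
    · have : Set.Ioi (0:ℝ) ⊆ (Function.support
          (fun g : ℝ => (g • Ω + Q⁻¹).det ^ (-(1:ℝ)/2) * pri g)) ∩ Set.Ioi 0 :=
        fun g hg => ⟨(mul_pos (hdp g hg) (hpri_pos g hg)).ne', hg⟩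
      refine lt_of_lt_of_le ?_ (measure_mono this)
      simp
    · refine (ae_restrict_iff' measurableSet_Ioi).2 (Eventually.of_forall fun g hg => ?_)
      exact (mul_pos (hdp g hg) (hpri_pos g hg)).le
  have hlow : ∀ θ : EuclideanSpace ℝ (Fin r1),
      (S1 + θ ⬝ᵥ Q.mulVec θ) ^ (-a1) * C ≤ ∫ g in Set.Ioi (0:ℝ),
          (g • Ω + Q⁻¹).det ^ (-(1:ℝ)/2) *
            (S1 + θ ⬝ᵥ ((g • Ω + Q⁻¹)⁻¹).mulVec θ) ^ (-a1) * pri g := by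
    intro θ
    have hqn : ∀ g : ℝ, 0 < g → 0 ≤ (θ : Fin r1 → ℝ) ⬝ᵥ ((g • Ω + Q⁻¹)⁻¹).mulVec θ := by
      intro g hg
      simpa using (hA g hg).inv.posSemidef.dotProduct_mulVec_nonneg (θ : Fin r1 → ℝ)
    have hqm : Measurable fun g : ℝ => (θ : Fin r1 → ℝ) ⬝ᵥ ((g • Ω + Q⁻¹)⁻¹).mulVec θ := by
      have e : (fun g : ℝ => (θ : Fin r1 → ℝ) ⬝ᵥ ((g • Ω + Q⁻¹)⁻¹).mulVec θ) = fun g : ℝ =>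
          ((g • Ω + Q⁻¹).det)⁻¹ * ((θ : Fin r1 → ℝ) ⬝ᵥ ((g • Ω + Q⁻¹).adjugate).mulVec θ) := by
        funext g
        rw [inv_def, Ring.inverse_eq_inv', smul_mulVec, dotProduct_smul, smul_eq_mul]
      rw [e]
      refine hdm.inv.mul ?_
      have hadj : Continuous fun g : ℝ => (g • Ω + Q⁻¹).adjugate :=
        Continuous.matrix_adjugate (by fun_prop)
      exact (Continuous.dotProduct continuous_const
        (hadj.matrix_mulVec continuous_const)).measurable
    rw [hC, ← integral_const_mul]
    refine setIntegral_mono_on (hint0.const_mul _) ?_ measurableSet_Ioi ?_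
    · have e : (fun g : ℝ => (g • Ω + Q⁻¹).det ^ (-(1:ℝ)/2) *
            (S1 + θ ⬝ᵥ ((g • Ω + Q⁻¹)⁻¹).mulVec θ) ^ (-a1) * pri g) = fun g : ℝ =>
            (S1 + θ ⬝ᵥ ((g • Ω + Q⁻¹)⁻¹).mulVec θ) ^ (-a1) *
            ((g • Ω + Q⁻¹).det ^ (-(1:ℝ)/2) * pri g) := by
        funext g; ring
      rw [e]
      refine Integrable.bdd_mul (c := S1 ^ (-a1)) hint0
        ((hqm.const_add _).pow_const _).aestronglyMeasurable ?_
      refine (ae_restrict_iff' measurableSet_Ioi).2 (Eventually.of_forall fun g hg => ?_)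
      have := hqn g hg
      rw [Real.norm_of_nonneg (by positivity)]
      exact Real.rpow_le_rpow_of_nonpos hS1p (by linarith) (by linarith)
    · intro g hg
      have h1 := hqn g hg
      have h2 := MixBF.quad_le hQ hΩ hg (θ : Fin r1 → ℝ)
      have h3 : (S1 + θ ⬝ᵥ Q.mulVec θ) ^ (-a1) ≤
          (S1 + θ ⬝ᵥ ((g • Ω + Q⁻¹)⁻¹).mulVec θ) ^ (-a1) :=
        Real.rpow_le_rpow_of_nonpos (by positivity) (by linarith) (by linarith)
      have h4 := mul_le_mul_of_nonneg_right h3 (mul_pos (hdp g hg) (hpri_pos g hg)).le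
      refine h4.trans (le_of_eq (by ring))
  set K : ℝ := 1 + S1 / S0 with hK
  have hKp : 0 < K := by positivity
  have hmain : ∀ θ : EuclideanSpace ℝ (Fin r1),
      (C * K ^ (-a1)) * (c * ‖θ‖ ^ 2) ^ (a0 - a1) ≤ Bmix θ := by
    intro θ
    rw [hBmix θ]
    have hq := hcoer θ
    have hl := hlow θ
    set q : ℝ := (θ : Fin r1 → ℝ) ⬝ᵥ Q.mulVec θ with hqdef
    have hq0 : 0 ≤ q := le_trans (by positivity) hq
    have hS0q : 0 < S0 + q := by positivity
    rw [le_div_iff₀ (Real.rpow_pos_of_pos hS0q _)]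
    refine le_trans ?_ hl
    have h1 : (c * ‖θ‖ ^ 2) ^ (a0 - a1) ≤ (S0 + q) ^ (a0 - a1) :=
      Real.rpow_le_rpow (by positivity) (by linarith) ha01.le
    have h2 : S1 + q ≤ K * (S0 + q) := by
      have : K * (S0 + q) = S0 + q + S1 + S1 / S0 * q := by
        rw [hK]; field_simp; ring
      have h' : 0 ≤ S1 / S0 * q := by positivity
      linarith
    have h3 : (K * (S0 + q)) ^ (-a1) ≤ (S1 + q) ^ (-a1) :=
      Real.rpow_le_rpow_of_nonpos (by positivity) h2 (by linarith)
    calc C * K ^ (-a1) * (c * ‖θ‖ ^ 2) ^ (a0 - a1) * (S0 + q) ^ (-a0)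
        ≤ C * K ^ (-a1) * (S0 + q) ^ (a0 - a1) * (S0 + q) ^ (-a0) := by gcongr
      _ = (K * (S0 + q)) ^ (-a1) * C := by
        rw [Real.mul_rpow hKp.le hS0q.le, mul_assoc, ← Real.rpow_add hS0q,
          show a0 - a1 + -a0 = -a1 by ring]
        ring
      _ ≤ _ := by gcongr
  refine tendsto_atTop_mono hmain ?_
  refine Tendsto.const_mul_atTop (by positivity) ?_
  refine (tendsto_rpow_atTop ha01).comp ?_
  refine Tendsto.const_mul_atTop hc ?_
  exact (tendsto_pow_atTop two_ne_zero).comp tendsto_comap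
end

section
/- Consider the scale-mixture Bayes factor B10^mix(θ̂) defined below with ν0 = ν1. Then the condition ∫₀^∞ (g+1)^{(n−r1−r2+ν1)/2} π(g) dg = ∞ is necessary and sufficient for information consistency, i.e., for B10^mix(θ̂) → ∞ as |θ̂| → ∞. -/
open MeasureTheory Filter Matrix

lemma aux_upper {d : ℕ} (A : Matrix (Fin d) (Fin d) ℝ) :
    ∃ K : ℝ, 0 < K ∧ ∀ x : Fin d → ℝ, x ⬝ᵥ A.mulVec x ≤ K * (x ⬝ᵥ x) := by
  refine ⟨(∑ i, ∑ j, |A i j|) + 1, by positivity, fun x => ?_⟩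
  have hx0 : 0 ≤ x ⬝ᵥ x := by
    simp only [dotProduct]; exact Finset.sum_nonneg fun i _ => mul_self_nonneg _
  have hx : ∀ i, x i * x i ≤ x ⬝ᵥ x := fun i => by
    simp only [dotProduct]
    exact Finset.single_le_sum (f := fun i => x i * x i)
      (fun i _ => mul_self_nonneg _) (Finset.mem_univ i)
  have : x ⬝ᵥ A.mulVec x ≤ (∑ i, ∑ j, |A i j|) * (x ⬝ᵥ x) := by
    rw [Finset.sum_mul]
    conv_lhs => simp only [dotProduct, mulVec, Finset.mul_sum]
    refine Finset.sum_le_sum fun i _ => ?_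
    rw [Finset.sum_mul]
    refine Finset.sum_le_sum fun j _ => ?_
    have h1 : |x i * x j| ≤ x ⬝ᵥ x := by
      rw [abs_le]
      constructor <;> nlinarith [hx i, hx j, sq_nonneg (x i + x j), sq_nonneg (x i - x j)]
    calc x i * (A i j * x j) = A i j * (x i * x j) := by ring
      _ ≤ |A i j * (x i * x j)| := le_abs_self _
      _ = |A i j| * |x i * x j| := abs_mul _ _
      _ ≤ _ := mul_le_mul_of_nonneg_left h1 (abs_nonneg _)
  linarith

lemma aux_symm {d : ℕ} {M : Matrix (Fin d) (Fin d) ℝ} (hM : M.PosDef) (x y : Fin d → ℝ) :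
    x ⬝ᵥ M.mulVec y = y ⬝ᵥ M.mulVec x := by
  have h : Mᵀ = M := by simpa [conjTranspose_eq_transpose_of_trivial] using hM.1.eq
  rw [dotProduct_mulVec, ← mulVec_transpose, h, dotProduct_comm]

lemma aux_quad {d : ℕ} {M : Matrix (Fin d) (Fin d) ℝ} (hM : M.PosDef) (x y : Fin d → ℝ) (s : ℝ) :
    (y - s • x) ⬝ᵥ M.mulVec (y - s • x) =
      y ⬝ᵥ M.mulVec y - 2 * s * (x ⬝ᵥ M.mulVec y) + s ^ 2 * (x ⬝ᵥ M.mulVec x) := by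
  simp only [mulVec_sub, mulVec_smul, dotProduct_sub, sub_dotProduct, smul_dotProduct,
    dotProduct_smul, smul_eq_mul]
  rw [aux_symm hM y x]; ring

lemma aux_cancel {d : ℕ} {M : Matrix (Fin d) (Fin d) ℝ} (hM : M.PosDef) (x : Fin d → ℝ) :
    M.mulVec (M⁻¹.mulVec x) = x := by
  have : IsUnit M.det := hM.det_pos.ne'.isUnit
  rw [mulVec_mulVec, mul_nonsing_inv _ this, one_mulVec]

lemma aux_inv_lower {d : ℕ} {M : Matrix (Fin d) (Fin d) ℝ} (hM : M.PosDef) {K : ℝ} (hK : 0 < K)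
    (h : ∀ x : Fin d → ℝ, x ⬝ᵥ M.mulVec x ≤ K * (x ⬝ᵥ x)) (x : Fin d → ℝ) :
    (x ⬝ᵥ x) / K ≤ x ⬝ᵥ M⁻¹.mulVec x := by
  have h1 := aux_quad hM x (M⁻¹.mulVec x) K⁻¹
  have h2 : 0 ≤ (M⁻¹.mulVec x - K⁻¹ • x) ⬝ᵥ M.mulVec (M⁻¹.mulVec x - K⁻¹ • x) := by
    simpa using hM.posSemidef.dotProduct_mulVec_nonneg (M⁻¹.mulVec x - K⁻¹ • x)
  rw [h1, aux_cancel hM, dotProduct_comm (M⁻¹.mulVec x) x] at h2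
  have h3 : K⁻¹ ^ 2 * (x ⬝ᵥ M.mulVec x) ≤ K⁻¹ ^ 2 * (K * (x ⬝ᵥ x)) :=
    mul_le_mul_of_nonneg_left (h x) (by positivity)
  have h4 : K⁻¹ ^ 2 * (K * (x ⬝ᵥ x)) = K⁻¹ * (x ⬝ᵥ x) := by field_simp
  rw [div_eq_inv_mul]; linarith

lemma aux_inv_upper {d : ℕ} {M : Matrix (Fin d) (Fin d) ℝ} (hM : M.PosDef) {k : ℝ} (hk : 0 < k)
    (h : ∀ x : Fin d → ℝ, k * (x ⬝ᵥ x) ≤ x ⬝ᵥ M.mulVec x) (x : Fin d → ℝ) :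
    x ⬝ᵥ M⁻¹.mulVec x ≤ (x ⬝ᵥ x) / k := by
  have h1 := aux_quad (PosDef.one (n := Fin d) (R := ℝ)) (M⁻¹.mulVec x) x k
  have h2 : 0 ≤ (x - k • M⁻¹.mulVec x) ⬝ᵥ (x - k • M⁻¹.mulVec x) := by
    simp only [dotProduct]; exact Finset.sum_nonneg fun i _ => mul_self_nonneg _
  simp only [one_mulVec] at h1
  have h3 := h (M⁻¹.mulVec x)
  rw [aux_cancel hM] at h3
  rw [h1] at h2
  rw [dotProduct_comm (M⁻¹.mulVec x) x] at h2 h3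
  have h4 := mul_le_mul_of_nonneg_left h3 hk.le
  rw [le_div_iff₀ hk]; nlinarith

lemma aux_lower {d : ℕ} {A : Matrix (Fin d) (Fin d) ℝ} (hA : A.PosDef) :
    ∃ k : ℝ, 0 < k ∧ ∀ x : Fin d → ℝ, k * (x ⬝ᵥ x) ≤ x ⬝ᵥ A.mulVec x := by
  obtain ⟨K, hK, h⟩ := aux_upper A⁻¹
  refine ⟨K⁻¹, by positivity, fun x => ?_⟩
  have := aux_inv_lower hA.inv hK h x
  rwa [nonsing_inv_nonsing_inv _ hA.det_pos.ne'.isUnit, div_eq_inv_mul] at this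

lemma aux_det {d : ℕ} {M : Matrix (Fin d) (Fin d) ℝ} (hM : M.PosDef) {k K : ℝ} (hk : 0 < k)
    (h1 : ∀ x : Fin d → ℝ, k * (x ⬝ᵥ x) ≤ x ⬝ᵥ M.mulVec x)
    (h2 : ∀ x : Fin d → ℝ, x ⬝ᵥ M.mulVec x ≤ K * (x ⬝ᵥ x)) :
    k ^ d ≤ M.det ∧ M.det ≤ K ^ d := by
  have hd : M.det = ∏ i, hM.1.eigenvalues i := by
    simpa using hM.1.det_eq_prod_eigenvalues
  have hv : ∀ i, (hM.1.eigenvectorBasis i).ofLp ⬝ᵥ (hM.1.eigenvectorBasis i).ofLp = 1 := by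
    intro i
    have h := hM.1.eigenvectorBasis.orthonormal.1 i
    have h' := EuclideanSpace.real_norm_sq_eq (hM.1.eigenvectorBasis i)
    rw [h] at h'
    simp only [dotProduct, ← sq]; linarith
  have he : ∀ i, hM.1.eigenvalues i =
      (hM.1.eigenvectorBasis i).ofLp ⬝ᵥ M.mulVec (hM.1.eigenvectorBasis i).ofLp := by
    intro i
    simpa using hM.1.eigenvalues_eq i
  have hl : ∀ i, k ≤ hM.1.eigenvalues i := fun i => by
    have := h1 (hM.1.eigenvectorBasis i).ofLp
    rw [hv, mul_one] at this; rw [he]; exact this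
  have hu : ∀ i, hM.1.eigenvalues i ≤ K := fun i => by
    have := h2 (hM.1.eigenvectorBasis i).ofLp
    rw [hv, mul_one] at this; rw [he]; exact this
  rw [hd]
  constructor
  · calc k ^ d = ∏ _i : Fin d, k := by simp
      _ ≤ _ := Finset.prod_le_prod (fun _ _ => hk.le) (fun i _ => hl i)
  · calc _ ≤ ∏ _i : Fin d, K :=
          Finset.prod_le_prod (fun i _ => hk.le.trans (hl i)) (fun i _ => hu i)
      _ = K ^ d := by simp

lemma aux_all {d : ℕ} {Q Ω : Matrix (Fin d) (Fin d) ℝ} (hQ : Q.PosDef) (hΩ : Ω.PosDef) :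
    ∃ k K : ℝ, 0 < k ∧ 0 < K ∧ ∀ g : ℝ, 0 < g →
      (k * (g + 1)) ^ d ≤ (g • Ω + Q⁻¹).det ∧ (g • Ω + Q⁻¹).det ≤ (K * (g + 1)) ^ d ∧
      ∀ x : Fin d → ℝ, (x ⬝ᵥ x) / (K * (g + 1)) ≤ x ⬝ᵥ (g • Ω + Q⁻¹)⁻¹.mulVec x ∧
        x ⬝ᵥ (g • Ω + Q⁻¹)⁻¹.mulVec x ≤ (x ⬝ᵥ x) / (k * (g + 1)) := by
  obtain ⟨k1, hk1, h1⟩ := aux_lower hΩ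
  obtain ⟨k2, hk2, h2⟩ := aux_lower hQ.inv
  obtain ⟨K1, hK1, h3⟩ := aux_upper Ω
  obtain ⟨K2, hK2, h4⟩ := aux_upper Q⁻¹
  refine ⟨min k1 k2, max K1 K2, lt_min hk1 hk2, lt_max_of_lt_left hK1, fun g hg => ?_⟩
  have hM : (g • Ω + Q⁻¹).PosDef := (hΩ.smul hg).add hQ.inv
  have hx0 : ∀ x : Fin d → ℝ, 0 ≤ x ⬝ᵥ x := fun x => by
    simp only [dotProduct]; exact Finset.sum_nonneg fun i _ => mul_self_nonneg _
  have hq : ∀ x : Fin d → ℝ, x ⬝ᵥ (g • Ω + Q⁻¹).mulVec x =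
      g * (x ⬝ᵥ Ω.mulVec x) + x ⬝ᵥ Q⁻¹.mulVec x := fun x => by
    simp [add_mulVec, smul_mulVec, dotProduct_add, dotProduct_smul]
  have hl : ∀ x : Fin d → ℝ,
      (min k1 k2 * (g + 1)) * (x ⬝ᵥ x) ≤ x ⬝ᵥ (g • Ω + Q⁻¹).mulVec x := fun x => by
    rw [hq]
    have e1 := mul_le_mul_of_nonneg_right (min_le_left k1 k2) (hx0 x)
    have e2 := mul_le_mul_of_nonneg_right (min_le_right k1 k2) (hx0 x)
    have e3 := mul_le_mul_of_nonneg_left (e1.trans (h1 x)) hg.le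
    have e4 := h2 x
    linarith
  have hu : ∀ x : Fin d → ℝ,
      x ⬝ᵥ (g • Ω + Q⁻¹).mulVec x ≤ (max K1 K2 * (g + 1)) * (x ⬝ᵥ x) := fun x => by
    rw [hq]
    have e1 := mul_le_mul_of_nonneg_right (le_max_left K1 K2) (hx0 x)
    have e2 := mul_le_mul_of_nonneg_right (le_max_right K1 K2) (hx0 x)
    have e3 := mul_le_mul_of_nonneg_left ((h3 x).trans e1) hg.le
    have e4 := h4 x
    linarith
  have hkp : 0 < min k1 k2 * (g + 1) := mul_pos (lt_min hk1 hk2) (by linarith)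
  have hKp : 0 < max K1 K2 * (g + 1) := mul_pos (lt_max_of_lt_left hK1) (by linarith)
  obtain ⟨d1, d2⟩ := aux_det hM hkp hl hu
  exact ⟨d1, d2, fun x => ⟨aux_inv_lower hM hKp hu x, aux_inv_upper hM hkp hl x⟩⟩

lemma aux_pow {d : ℕ} {k w : ℝ} (hk : 0 < k) (hw : 0 < w) :
    ((k * w) ^ d) ^ (-(1:ℝ)/2) = k ^ (-(d:ℝ)/2) * w ^ (-(d:ℝ)/2) := by
  rw [← Real.rpow_natCast, ← Real.rpow_mul (by positivity), Real.mul_rpow hk.le hw.le]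
  congr 2 <;> ring

lemma aux_ub {d : ℕ} {k K q c0 c1 a D w t u v : ℝ} (hk : 0 < k) (hK : 0 < K) (hq : 0 < q)
    (hc0 : 0 < c0) (hc1 : 0 < c1) (ha : 0 < a) (hw : 1 ≤ w) (ht : 0 ≤ t) (hv0 : 0 ≤ v)
    (hD : (k * w) ^ d ≤ D) (hu : t / (K * w) ≤ u) (hv : v ≤ q * t) :
    D ^ (-(1:ℝ)/2) * (c1 + u) ^ (-a) * (c0 + v) ^ a ≤
      (k ^ (-(d:ℝ)/2) * (c0 / c1 + q * K) ^ a) * w ^ (a - d / 2) := by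
  have hw0 : 0 < w := by linarith
  have hu0 : 0 ≤ u := le_trans (by positivity) hu
  have hX : 0 < c1 + u := by linarith
  have h1 : D ^ (-(1:ℝ)/2) ≤ k ^ (-(d:ℝ)/2) * w ^ (-(d:ℝ)/2) := by
    rw [← aux_pow hk hw0]
    exact Real.rpow_le_rpow_of_nonpos (by positivity) hD (by norm_num)
  have h2 : c0 + v ≤ ((c0 / c1 + q * K) * w) * (c1 + u) := by
    rw [div_le_iff₀ (by positivity)] at hu
    have e1 : v ≤ q * K * w * u := by
      calc v ≤ q * t := hv
        _ ≤ q * (u * (K * w)) := mul_le_mul_of_nonneg_left hu hq.le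
        _ = _ := by ring
    have e2 : c0 ≤ c0 / c1 * w * c1 := by
      have : c0 / c1 * w * c1 = c0 * w := by field_simp
      rw [this]; nlinarith
    have e3 : 0 ≤ c0 / c1 * w * u := by positivity
    have e4 : 0 ≤ q * K * w * c1 := by positivity
    nlinarith
  have h3 : (c1 + u) ^ (-a) * (c0 + v) ^ a ≤ (c0 / c1 + q * K) ^ a * w ^ a := by
    have := Real.rpow_le_rpow (by positivity) h2 ha.le
    rw [Real.mul_rpow (by positivity) hX.le, Real.mul_rpow (by positivity) hw0.le] at this
    rw [Real.rpow_neg hX.le, inv_mul_le_iff₀ (by positivity)]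
    linarith
  have hD0 : 0 ≤ D := le_trans (by positivity) hD
  calc _ = D ^ (-(1:ℝ)/2) * ((c1 + u) ^ (-a) * (c0 + v) ^ a) := by ring
    _ ≤ (k ^ (-(d:ℝ)/2) * w ^ (-(d:ℝ)/2)) * ((c0 / c1 + q * K) ^ a * w ^ a) :=
        mul_le_mul h1 h3 (by positivity) (by positivity)
    _ = (k ^ (-(d:ℝ)/2) * (c0 / c1 + q * K) ^ a) * (w ^ a * w ^ (-(d:ℝ)/2)) := by ring
    _ = _ := by rw [← Real.rpow_add hw0]; congr 2; ring

lemma aux_lb {d : ℕ} {k K q c0 c1 a D w W t u v : ℝ} (hk : 0 < k) (hK : 0 < K) (hq : 0 < q)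
    (hc0 : 0 < c0) (hc1 : 0 < c1) (ha : 0 < a) (hw : 1 ≤ w) (hwW : w ≤ W)
    (ht : c1 * k * W ≤ t) (hu0 : 0 ≤ u) (hD0 : 0 < D)
    (hD : D ≤ (K * w) ^ d) (hu : u ≤ t / (k * w)) (hv : q * t ≤ v) :
    (K ^ (-(d:ℝ)/2) * (q * k / 2) ^ a) * w ^ (a - d / 2) ≤
    D ^ (-(1:ℝ)/2) * (c1 + u) ^ (-a) * (c0 + v) ^ a := by
  have hw0 : 0 < w := by linarith
  have hX : 0 < c1 + u := by linarith
  have h1 : K ^ (-(d:ℝ)/2) * w ^ (-(d:ℝ)/2) ≤ D ^ (-(1:ℝ)/2) := by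
    rw [← aux_pow hK hw0]
    exact Real.rpow_le_rpow_of_nonpos hD0 hD (by norm_num)
  have h2 : ((q * k / 2) * w) * (c1 + u) ≤ c0 + v := by
    rw [le_div_iff₀ (by positivity)] at hu
    have e1 : c1 * k * w ≤ t := le_trans (mul_le_mul_of_nonneg_left hwW (by positivity)) ht
    have e2 : (q / 2) * (c1 * k * w + u * (k * w)) ≤ (q / 2) * (t + t) :=
      mul_le_mul_of_nonneg_left (by linarith) (by positivity)
    nlinarith
  have h3 : (q * k / 2) ^ a * w ^ a ≤ (c1 + u) ^ (-a) * (c0 + v) ^ a := by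
    have := Real.rpow_le_rpow (by positivity) h2 ha.le
    rw [Real.mul_rpow (by positivity) hX.le, Real.mul_rpow (by positivity) hw0.le] at this
    rw [Real.rpow_neg hX.le, le_inv_mul_iff₀ (by positivity)]
    linarith
  calc _ = (K ^ (-(d:ℝ)/2) * (q * k / 2) ^ a) * (w ^ a * w ^ (-(d:ℝ)/2)) := by
        rw [← Real.rpow_add hw0]; congr 2; ring
    _ = (K ^ (-(d:ℝ)/2) * w ^ (-(d:ℝ)/2)) * ((q * k / 2) ^ a * w ^ a) := by ring
    _ ≤ D ^ (-(1:ℝ)/2) * ((c1 + u) ^ (-a) * (c0 + v) ^ a) :=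
        mul_le_mul h1 h3 (by positivity) (by positivity)
    _ = _ := by ring

lemma aux_meas {d : ℕ} (Q Ω : Matrix (Fin d) (Fin d) ℝ) (c a : ℝ) (x : Fin d → ℝ)
    (pri : ℝ → ℝ) (h : Measurable pri) :
    Measurable (fun g : ℝ => (g • Ω + Q⁻¹).det ^ (-(1:ℝ)/2) *
      (c + x ⬝ᵥ ((g • Ω + Q⁻¹)⁻¹).mulVec x) ^ (-a) * pri g) := by
  have hM : Continuous (fun g : ℝ => g • Ω + Q⁻¹) := by fun_prop
  have hdet : Measurable (fun g : ℝ => (g • Ω + Q⁻¹).det) := hM.matrix_det.measurable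
  have hadj : Measurable (fun g : ℝ => x ⬝ᵥ ((g • Ω + Q⁻¹).adjugate).mulVec x) := by
    apply Continuous.measurable
    exact continuous_const.dotProduct (hM.matrix_adjugate.matrix_mulVec continuous_const)
  have : ∀ g : ℝ, x ⬝ᵥ ((g • Ω + Q⁻¹)⁻¹).mulVec x =
      (g • Ω + Q⁻¹).det⁻¹ * (x ⬝ᵥ ((g • Ω + Q⁻¹).adjugate).mulVec x) := fun g => by
    rw [inv_def, Ring.inverse_eq_inv', smul_mulVec, dotProduct_smul, smul_eq_mul]
  simp only [this]
  exact ((hdet.pow_const _).mul ((measurable_const.add (hdet.inv.mul hadj)).pow_const _)).mul h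

/-- For the scale-mixture Bayes factor with ν0 = ν1, the condition
∫₀^∞ (g+1)^{(n−r1−r2+ν1)/2} π(g) dg = ∞ is necessary and sufficient for information
consistency, i.e. for B10^mix → ∞ as |θ̂| → ∞. -/
theorem mixture_bayes_factor_iff_of_nu0_eq_nu1
    (n r1 r2 : ℕ) (hn : 1 ≤ n) (hr1 : 1 ≤ r1)
    (Q Ω : Matrix (Fin r1) (Fin r1) ℝ) (hQ : Q.PosDef) (hΩ : Ω.PosDef)
    (ν0 ν1 : ℝ) (hν0 : 0 ≤ ν0) (hν1 : 0 ≤ ν1)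
    (hdf : 0 < (n : ℝ) - r1 - r2 + ν1)
    (s0sq s1sq : ℝ) (hs0 : 0 < s0sq) (hs1 : 0 < s1sq)
    (sysq : ℝ) (hsy : 0 < sysq)
    (pri : ℝ → ℝ) (hpri_meas : Measurable pri)
    (hpri_nonneg : ∀ g ∈ Set.Ioi (0:ℝ), 0 ≤ pri g)
    (hpri_int : ∫ g in Set.Ioi (0:ℝ), pri g = 1)
    (Bmix : EuclideanSpace ℝ (Fin r1) → ℝ)
    (hBmix : ∀ θhat : EuclideanSpace ℝ (Fin r1),
      Bmix θhat =
        (∫ g in Set.Ioi (0:ℝ),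
          (g • Ω + Q⁻¹).det ^ (-(1:ℝ)/2) *
            (ν1 * s1sq + sysq + θhat ⬝ᵥ ((g • Ω + Q⁻¹)⁻¹).mulVec θhat)
              ^ (-(((n:ℝ) - r2 + ν1) / 2)) * pri g) /
        (ν0 * s0sq + sysq + θhat ⬝ᵥ Q.mulVec θhat)
          ^ (-(((n:ℝ) - r2 + ν0) / 2)))
    (hν : ν0 = ν1) :
    (¬ IntegrableOn (fun g : ℝ => (g + 1) ^ (((n:ℝ) - r1 - r2 + ν1) / 2) * pri g)
        (Set.Ioi (0:ℝ))) ↔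
      Tendsto Bmix (comap (fun θhat : EuclideanSpace ℝ (Fin r1) => ‖θhat‖) atTop) atTop := by
  subst hν
  obtain ⟨k, K, hk, hK, hall⟩ := aux_all hQ hΩ
  obtain ⟨q0, hq0, hQl⟩ := aux_lower hQ
  obtain ⟨q, hq, hQu⟩ := aux_upper Q
  set c0 := ν0 * s0sq + sysq with hc0def
  set c1 := ν0 * s1sq + sysq with hc1def
  have hc0 : 0 < c0 := by positivity
  have hc1 : 0 < c1 := by positivity
  set a : ℝ := ((n:ℝ) - r2 + ν0) / 2 with hadef
  have hr1' : (1:ℝ) ≤ r1 := by exact_mod_cast hr1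
  have ha : 0 < a := by rw [hadef]; linarith
  have hexp : ((n:ℝ) - r1 - r2 + ν0) / 2 = a - (r1:ℝ) / 2 := by rw [hadef]; ring
  rw [hexp]
  have hx0 : ∀ x : Fin r1 → ℝ, 0 ≤ x ⬝ᵥ x := fun x => by
    simp only [dotProduct]; exact Finset.sum_nonneg fun i _ => mul_self_nonneg _
  have hpi : IntegrableOn pri (Set.Ioi (0:ℝ)) := by
    by_contra h
    rw [integral_undef h] at hpri_int
    norm_num at hpri_int
  have hB : ∀ θ : EuclideanSpace ℝ (Fin r1), Bmix θ = ∫ g in Set.Ioi (0:ℝ),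
      ((g • Ω + Q⁻¹).det ^ (-(1:ℝ)/2) *
            (c1 + θ.ofLp ⬝ᵥ ((g • Ω + Q⁻¹)⁻¹).mulVec θ.ofLp) ^ (-a) * pri g) *
        (c0 + θ.ofLp ⬝ᵥ Q.mulVec θ.ofLp) ^ a := fun θ => by
    have hv0 : 0 ≤ θ.ofLp ⬝ᵥ Q.mulVec θ.ofLp :=
      le_trans (mul_nonneg hq0.le (hx0 _)) (hQl _)
    rw [integral_mul_const, hBmix θ, Real.rpow_neg (by linarith), div_inv_eq_mul]
  have hu0 : ∀ (x : Fin r1 → ℝ) (g : ℝ), 0 < g →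
      0 ≤ x ⬝ᵥ ((g • Ω + Q⁻¹)⁻¹).mulVec x := fun x g hg =>
    le_trans (div_nonneg (hx0 x) (by positivity)) ((hall g hg).2.2 x).1
  have hFnn : ∀ (x : Fin r1 → ℝ), ∀ g ∈ Set.Ioi (0:ℝ), 0 ≤ (g • Ω + Q⁻¹).det ^ (-(1:ℝ)/2) *
            (c1 + x ⬝ᵥ ((g • Ω + Q⁻¹)⁻¹).mulVec x) ^ (-a) * pri g := fun x g hg => by
    have hg' : 0 < g := hg
    have h1 : 0 ≤ (g • Ω + Q⁻¹).det := le_trans (by positivity) (hall g hg').1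
    have h2 := hu0 x g hg'
    have h3 := hpri_nonneg g hg
    positivity
  have hFint : ∀ x : Fin r1 → ℝ, IntegrableOn (fun g : ℝ => (g • Ω + Q⁻¹).det ^ (-(1:ℝ)/2) *
            (c1 + x ⬝ᵥ ((g • Ω + Q⁻¹)⁻¹).mulVec x) ^ (-a) * pri g) (Set.Ioi 0) := fun x => by
    refine Integrable.mono' (hpi.const_mul ((k ^ r1) ^ (-(1:ℝ)/2) * c1 ^ (-a)))
      (aux_meas Q Ω c1 a x pri hpri_meas).aestronglyMeasurable ?_
    refine (ae_restrict_iff' measurableSet_Ioi).2 (Eventually.of_forall fun g hg => ?_)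
    have hg' : 0 < g := hg
    rw [Real.norm_of_nonneg (hFnn x g hg)]
    have h1 : k ^ r1 ≤ (g • Ω + Q⁻¹).det := by
      refine le_trans ?_ (hall g hg').1
      exact pow_le_pow_left₀ hk.le (by nlinarith) _
    have h2 := hu0 x g hg'
    refine mul_le_mul_of_nonneg_right ?_ (hpri_nonneg g hg)
    refine mul_le_mul (Real.rpow_le_rpow_of_nonpos (by positivity) h1 (by norm_num))
      (Real.rpow_le_rpow_of_nonpos hc1 (by linarith) (by linarith)) ?_ (by positivity)
    positivity
  constructor
  · intro hni
    rw [tendsto_atTop]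
    intro b
    -- the truncated integrals are unbounded
    have hloc : ∀ N : ℝ, IntegrableOn
        (fun g : ℝ => (g + 1) ^ (a - (r1:ℝ) / 2) * pri g) (Set.Ioc 0 N) := fun N => by
      refine Integrable.mono'
        ((hpi.mono_set Set.Ioc_subset_Ioi_self).const_mul ((N + 1) ^ (a - (r1:ℝ) / 2)))
        (((measurable_id.add_const 1).pow_const _).mul hpri_meas).aestronglyMeasurable ?_
      refine (ae_restrict_iff' measurableSet_Ioc).2 (Eventually.of_forall fun g hg => ?_)
      have hp := hpri_nonneg g hg.1
      have hg1 : 0 < g := hg.1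
      rw [Real.norm_of_nonneg (by positivity)]
      refine mul_le_mul_of_nonneg_right ?_ hp
      refine Real.rpow_le_rpow (by positivity) (by linarith [hg.2]) ?_
      rw [← hexp]; linarith
    set C := K ^ (-(r1:ℝ)/2) * (q0 * k / 2) ^ a with hC
    have hCpos : 0 < C := by positivity
    have hN : ∃ N : ℝ, 0 < N ∧
        b / C < ∫ g in Set.Ioc 0 N, (g + 1) ^ (a - (r1:ℝ) / 2) * pri g := by
      by_contra! hcon
      apply hni
      refine integrableOn_Ioi_of_intervalIntegral_norm_bounded (b / C) 0 (l := atTop)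
        (b := fun N : ℝ => N) hloc tendsto_id ?_
      filter_upwards [eventually_gt_atTop 0] with N hN
      rw [intervalIntegral.integral_of_le hN.le]
      refine le_trans (le_of_eq ?_) (hcon N hN)
      refine setIntegral_congr_fun measurableSet_Ioc fun g hg => ?_
      have hp := hpri_nonneg g hg.1
      have hg1 : 0 < g := hg.1
      exact Real.norm_of_nonneg (by positivity)
    obtain ⟨N, hN0, hNb⟩ := hN
    have hev : ∀ᶠ θ : EuclideanSpace ℝ (Fin r1) in comap (fun θ => ‖θ‖) atTop,
        c1 * k * (N + 1) ≤ ‖θ‖ ^ 2 :=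
      ((tendsto_pow_atTop (two_ne_zero)).comp tendsto_comap).eventually_ge_atTop _
    filter_upwards [hev] with θ hθ
    have ht : c1 * k * (N + 1) ≤ θ.ofLp ⬝ᵥ θ.ofLp := by
      rw [EuclideanSpace.real_norm_sq_eq] at hθ
      simpa only [dotProduct, ← sq] using hθ
    have hv0 : 0 ≤ θ.ofLp ⬝ᵥ Q.mulVec θ.ofLp :=
      le_trans (mul_nonneg hq0.le (hx0 _)) (hQl _)
    have hXa : 0 ≤ (c0 + θ.ofLp ⬝ᵥ Q.mulVec θ.ofLp) ^ a := by positivity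
    rw [hB]
    rw [div_lt_iff₀ hCpos, mul_comm, ← integral_const_mul] at hNb
    refine hNb.le.trans ?_
    refine le_trans (setIntegral_mono_on ((hloc N).const_mul C)
      (((hFint θ.ofLp).mono_set Set.Ioc_subset_Ioi_self).mul_const _) measurableSet_Ioc
      fun g hg => ?_) (setIntegral_mono_set ((hFint θ.ofLp).mul_const _) ?_
        (Eventually.of_forall Set.Ioc_subset_Ioi_self))
    · have hg1 : 0 < g := hg.1
      obtain ⟨e1, e2, e3⟩ := hall g hg1
      have key := aux_lb (d := r1) (w := g + 1) (W := N + 1) hk hK hq0 hc0 hc1 ha (by linarith)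
        (by linarith [hg.2]) ht (hu0 _ g hg1) (lt_of_lt_of_le (by positivity) e1) e2
        (e3 θ.ofLp).2 (hQl θ.ofLp)
      have := mul_le_mul_of_nonneg_right key (hpri_nonneg g hg.1)
      rw [← hC] at this
      linarith
    · refine (ae_restrict_iff' measurableSet_Ioi).2 (Eventually.of_forall fun g hg => ?_)
      exact mul_nonneg (hFnn _ g hg) hXa
  · intro htend hint
    set C := k ^ (-(r1:ℝ)/2) * (c0 / c1 + q * K) ^ a with hC
    have hbd : ∀ θ, Bmix θ ≤
        ∫ g in Set.Ioi (0:ℝ), C * ((g + 1) ^ (a - (r1:ℝ) / 2) * pri g) := fun θ => by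
      rw [hB]
      refine setIntegral_mono_on ((hFint θ.ofLp).mul_const _) (hint.const_mul C)
        measurableSet_Ioi fun g hg => ?_
      have hg1 : 0 < g := hg
      obtain ⟨e1, e2, e3⟩ := hall g hg1
      have hv0 : 0 ≤ θ.ofLp ⬝ᵥ Q.mulVec θ.ofLp :=
        le_trans (mul_nonneg hq0.le (hx0 _)) (hQl _)
      have key := aux_ub (d := r1) (w := g + 1) hk hK hq hc0 hc1 ha (by linarith)
        (hx0 θ.ofLp) hv0 e1 (e3 θ.ofLp).1 (hQu θ.ofLp)
      have := mul_le_mul_of_nonneg_right key (hpri_nonneg g hg)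
      rw [← hC] at this
      linarith
    haveI : Nonempty (Fin r1) := ⟨⟨0, hr1⟩⟩
    haveI : NeBot (comap (fun θhat : EuclideanSpace ℝ (Fin r1) => ‖θhat‖) atTop) := by
      rw [comap_norm_atTop]; infer_instance
    obtain ⟨θ, hθ⟩ := (htend.eventually_gt_atTop
      (∫ g in Set.Ioi (0:ℝ), C * ((g + 1) ^ (a - (r1:ℝ) / 2) * pri g))).exists
    exact absurd (hbd θ) (not_le.2 hθ)
end

section
/- Consider the scale-mixture Bayes factor B10^mix(θ̂) defined below with ν0 < ν1. If there exist 0 < M < ∞ and 0 < K < ∞ such that π(g) ≥ K g^{−α} for all g ≥ M, where α > 1, and α < (n − r1 − r2 + ν0)/2 + 1, then B10^mix(θ̂) → ∞ as |θ̂| → ∞ (information consistency). -/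
open MeasureTheory Filter Matrix

lemma aux_pd {r : ℕ} {A B : Matrix (Fin r) (Fin r) ℝ} (hA : A.PosDef) (hB : B.PosDef) {u : ℝ}
    (hu : 0 ≤ u) : (u • A + B).PosDef := by
  exact Matrix.PosDef.posSemidef_add (hA.posSemidef.smul hu) hB

lemma aux_cont {r : ℕ} {A B : Matrix (Fin r) (Fin r) ℝ} :
    Continuous (fun u : ℝ => u • A + B) := by fun_prop

lemma aux_det_cont {r : ℕ} {A B : Matrix (Fin r) (Fin r) ℝ} :
    Continuous (fun u : ℝ => (u • A + B).det) := aux_cont.matrix_det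

lemma aux_inv_cont {r : ℕ} {A B : Matrix (Fin r) (Fin r) ℝ} (hA : A.PosDef) (hB : B.PosDef) :
    ContinuousOn (fun u : ℝ => (u • A + B)⁻¹) (Set.Ici 0) := by
  have : (fun u : ℝ => (u • A + B)⁻¹) = fun u : ℝ => ((u • A + B).det)⁻¹ • (u • A + B).adjugate := by
    funext u; rw [Matrix.inv_def, Ring.inverse_eq_inv']
  rw [this]
  exact (aux_det_cont.continuousOn.inv₀ (fun u hu => (aux_pd hA hB hu).det_pos.ne')).smul
    aux_cont.matrix_adjugate.continuousOn

lemma aux_factor {r : ℕ} (A B : Matrix (Fin r) (Fin r) ℝ) {g : ℝ} (hg : 0 < g) :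
    g • A + B = g • (g⁻¹ • B + A) := by
  rw [smul_add, smul_smul, mul_inv_cancel₀ hg.ne', one_smul, add_comm]

lemma aux_det_upper {r : ℕ} (A B : Matrix (Fin r) (Fin r) ℝ) :
    ∃ C > 0, ∀ g : ℝ, 1 ≤ g → (g • A + B).det ≤ C * g ^ r := by
  obtain ⟨C, hC⟩ := (isCompact_Icc (a := (0:ℝ)) (b := 1)).exists_bound_of_continuousOn
    (aux_det_cont (A := B) (B := A)).continuousOn
  refine ⟨max C 1, by positivity, fun g hg => ?_⟩
  have hg0 : 0 < g := by linarith
  rw [aux_factor A B hg0, Matrix.det_smul, Fintype.card_fin, mul_comm]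
  gcongr
  have := hC g⁻¹ ⟨by positivity, inv_le_one_of_one_le₀ hg⟩
  exact (le_abs_self _).trans (this.trans (le_max_left _ _))

lemma aux_det_lower {r : ℕ} {A B : Matrix (Fin r) (Fin r) ℝ} (hA : A.PosDef) (hB : B.PosDef) :
    ∃ c > 0, ∀ g : ℝ, 0 ≤ g → c ≤ (g • A + B).det := by
  obtain ⟨c, hc0, hc⟩ := (isCompact_Icc (a := (0:ℝ)) (b := 1)).exists_forall_le'
    (aux_det_cont (A := B) (B := A)).continuousOn (a := 0)
    (fun u hu => (aux_pd hB hA hu.1).det_pos)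
  obtain ⟨d, hd0, hd⟩ := (isCompact_Icc (a := (0:ℝ)) (b := 1)).exists_forall_le'
    (aux_det_cont (A := A) (B := B)).continuousOn (a := 0)
    (fun u hu => (aux_pd hA hB hu.1).det_pos)
  refine ⟨min c d, lt_min hc0 hd0, fun g hg => ?_⟩
  rcases le_total g 1 with h | h
  · exact (min_le_right _ _).trans (hd g ⟨hg, h⟩)
  · have hg0 : 0 < g := by linarith
    rw [aux_factor A B hg0, Matrix.det_smul, Fintype.card_fin]
    have := hc g⁻¹ ⟨by positivity, inv_le_one_of_one_le₀ h⟩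
    have h1 : 1 ≤ g ^ r := one_le_pow₀ h
    have := min_le_left c d
    nlinarith

lemma aux_scale {r : ℕ} (A : Matrix (Fin r) (Fin r) ℝ) (x : EuclideanSpace ℝ (Fin r)) (hx : x ≠ 0) :
    x ⬝ᵥ A.mulVec x = ‖x‖ ^ 2 * ((‖x‖⁻¹ • x.ofLp) ⬝ᵥ A.mulVec (‖x‖⁻¹ • x.ofLp)) := by
  have : ‖x‖ ≠ 0 := norm_ne_zero_iff.2 hx
  simp only [Matrix.mulVec_smul, smul_dotProduct, dotProduct_smul, smul_eq_mul]
  field_simp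

lemma aux_quad_upper {r : ℕ} {A B : Matrix (Fin r) (Fin r) ℝ} (hA : A.PosDef) (hB : B.PosDef) :
    ∃ C > 0, ∀ g : ℝ, 1 ≤ g → ∀ x : EuclideanSpace ℝ (Fin r),
      x ⬝ᵥ ((g • A + B)⁻¹).mulVec x ≤ C * (‖x‖ ^ 2 / g) := by
  have hc : ContinuousOn (fun p : ℝ × EuclideanSpace ℝ (Fin r) =>
      p.2 ⬝ᵥ ((p.1 • B + A)⁻¹).mulVec p.2) (Set.Icc 0 1 ×ˢ Metric.sphere 0 1) := by
    have h1 : ContinuousOn (fun p : ℝ × EuclideanSpace ℝ (Fin r) => (p.1 • B + A)⁻¹)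
      (Set.Icc 0 1 ×ˢ Metric.sphere 0 1) :=
      (aux_inv_cont hB hA).comp continuousOn_fst (fun p hp => hp.1.1)
    rw [continuousOn_iff_continuous_domRestrict] at h1 ⊢
    have h2 : Continuous ((Set.Icc (0:ℝ) 1 ×ˢ Metric.sphere 0 1).domRestrict
      (fun p : ℝ × EuclideanSpace ℝ (Fin r) => (p.2 : Fin r → ℝ))) := by
      rw [← continuousOn_iff_continuous_domRestrict]
      fun_prop
    exact h2.dotProduct (h1.matrix_mulVec h2)
  obtain ⟨C, hC⟩ := ((isCompact_Icc (a := (0:ℝ)) (b := 1)).prod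
    (isCompact_sphere (0 : EuclideanSpace ℝ (Fin r)) 1)).exists_bound_of_continuousOn hc
  refine ⟨max C 1, by positivity, fun g hg x => ?_⟩
  have hg0 : 0 < g := by linarith
  by_cases hx : x = 0
  · subst hx; simp
  have hxn : ‖x‖ ≠ 0 := norm_ne_zero_iff.2 hx
  have hdet : IsUnit (g⁻¹ • B + A).det :=
    (aux_pd hB hA (inv_pos.2 hg0).le).det_pos.ne'.isUnit
  have hinv : (g • A + B)⁻¹ = g⁻¹ • (g⁻¹ • B + A)⁻¹ := by
    rw [aux_factor A B hg0]
    apply Matrix.inv_eq_right_inv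
    rw [smul_mul_smul_comm, Matrix.mul_nonsing_inv _ hdet, mul_inv_cancel₀ hg0.ne', one_smul]
  have := hC (g⁻¹, ‖x‖⁻¹ • x) ⟨⟨by positivity, inv_le_one_of_one_le₀ hg⟩, by
    simp [norm_smul, hxn]⟩
  rw [hinv, Matrix.smul_mulVec, dotProduct_smul, aux_scale _ x hx, smul_eq_mul]
  have h3 := (le_abs_self _).trans (this.trans (le_max_left C 1))
  simp only [WithLp.ofLp_smul] at h3
  calc _ ≤ g⁻¹ * (‖x‖ ^ 2 * (max C 1)) := by gcongr
    _ = _ := by field_simp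

lemma aux_quad_lower {r : ℕ} {A : Matrix (Fin r) (Fin r) ℝ} (hA : A.PosDef) :
    ∃ c > 0, ∀ x : EuclideanSpace ℝ (Fin r), c * ‖x‖ ^ 2 ≤ x ⬝ᵥ A.mulVec x := by
  have hc : Continuous (fun x : EuclideanSpace ℝ (Fin r) => x ⬝ᵥ A.mulVec x) := by
    have h2 : Continuous (fun p : EuclideanSpace ℝ (Fin r) => (p : Fin r → ℝ)) := by fun_prop
    exact h2.dotProduct (continuous_const.matrix_mulVec h2)
  obtain ⟨c, hc0, h⟩ := (isCompact_sphere (0 : EuclideanSpace ℝ (Fin r)) 1).exists_forall_le'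
    hc.continuousOn (a := 0) (fun x hx => by
      have : (x : Fin r → ℝ) ≠ 0 := by
        intro h0
        have : x = 0 := by ext i; exact congrFun h0 i
        subst this; simp at hx
      simpa using hA.dotProduct_mulVec_pos this)
  refine ⟨c, hc0, fun x => ?_⟩
  by_cases hx : x = 0
  · subst hx; simp
  have hxn : ‖x‖ ≠ 0 := norm_ne_zero_iff.2 hx
  rw [aux_scale _ x hx, mul_comm]
  gcongr
  have := h (‖x‖⁻¹ • x) (by simp [norm_smul, hxn])
  simpa only [WithLp.ofLp_smul] using this

lemma aux_quad_nonneg {r : ℕ} {A : Matrix (Fin r) (Fin r) ℝ} (hA : A.PosSemidef)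
    (x : EuclideanSpace ℝ (Fin r)) : 0 ≤ x ⬝ᵥ A.mulVec x := by
  simpa using hA.dotProduct_mulVec_nonneg (x : Fin r → ℝ)

/-- ν0 < ν1, polynomial lower tail π(g) ≥ K g^{−α} for g ≥ M with
1 < α < (n−r1−r2+ν0)/2 + 1 implies information consistency: B10^mix → ∞ as |θ̂| → ∞. -/
theorem mixture_bayes_factor_consistent_of_polynomial_lower_tail
    (n r1 r2 : ℕ) (hn : 1 ≤ n) (hr1 : 1 ≤ r1)
    (Q Ω : Matrix (Fin r1) (Fin r1) ℝ) (hQ : Q.PosDef) (hΩ : Ω.PosDef)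
    (ν0 ν1 : ℝ) (hν0 : 0 ≤ ν0) (hν1 : 0 ≤ ν1)
    (hdf : 0 < (n : ℝ) - r1 - r2 + ν1)
    (s0sq s1sq : ℝ) (hs0 : 0 < s0sq) (hs1 : 0 < s1sq)
    (sysq : ℝ) (hsy : 0 < sysq)
    (pri : ℝ → ℝ) (hpri_meas : Measurable pri)
    (hpri_nonneg : ∀ g ∈ Set.Ioi (0:ℝ), 0 ≤ pri g)
    (hpri_int : ∫ g in Set.Ioi (0:ℝ), pri g = 1)
    (Bmix : EuclideanSpace ℝ (Fin r1) → ℝ)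
    (hBmix : ∀ θhat : EuclideanSpace ℝ (Fin r1),
      Bmix θhat =
        (∫ g in Set.Ioi (0:ℝ),
          (g • Ω + Q⁻¹).det ^ (-(1:ℝ)/2) *
            (ν1 * s1sq + sysq + θhat ⬝ᵥ ((g • Ω + Q⁻¹)⁻¹).mulVec θhat)
              ^ (-(((n:ℝ) - r2 + ν1) / 2)) * pri g) /
        (ν0 * s0sq + sysq + θhat ⬝ᵥ Q.mulVec θhat)
          ^ (-(((n:ℝ) - r2 + ν0) / 2)))
    (hν : ν0 < ν1)
    (M K α : ℝ) (hM : 0 < M) (hK : 0 < K) (hα : 1 < α)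
    (htail : ∀ g : ℝ, M ≤ g → K * g ^ (-α) ≤ pri g)
    (hαbound : α < ((n:ℝ) - r1 - r2 + ν0) / 2 + 1) :
    Tendsto Bmix (comap (fun θhat : EuclideanSpace ℝ (Fin r1) => ‖θhat‖) atTop) atTop := by
  set a1 : ℝ := ((n:ℝ) - r2 + ν1) / 2 with ha1
  set a0 : ℝ := ((n:ℝ) - r2 + ν0) / 2 with ha0
  set S1 : ℝ := ν1 * s1sq + sysq with hS1
  set S0 : ℝ := ν0 * s0sq + sysq with hS0
  have hr : (1:ℝ) ≤ r1 := by exact_mod_cast hr1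
  have ha1p : 0 < a1 := by rw [ha1]; linarith
  have ha0p : 0 < a0 := by rw [ha0]; linarith
  have hS1p : 0 < S1 := by positivity
  have hS0p : 0 < S0 := by positivity
  have hQi : (Q⁻¹).PosDef := hQ.inv
  obtain ⟨C, hC0, hC⟩ := aux_det_upper Ω Q⁻¹
  obtain ⟨d, hd0, hd⟩ := aux_det_lower hΩ hQi
  obtain ⟨D, hD0, hD⟩ := aux_quad_upper hΩ hQi
  obtain ⟨q, hq0, hq⟩ := aux_quad_lower hQ
  have hpri : IntegrableOn pri (Set.Ioi 0) := by
    by_contra h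
    rw [integral_undef h] at hpri_int
    exact zero_ne_one hpri_int
  have hquad : ∀ g : ℝ, 0 ≤ g → ∀ x : EuclideanSpace ℝ (Fin r1),
      0 ≤ x ⬝ᵥ ((g • Ω + Q⁻¹)⁻¹).mulVec x := fun g hg x =>
    aux_quad_nonneg (aux_pd hΩ hQi hg).inv.posSemidef x
  have hnn : ∀ x : EuclideanSpace ℝ (Fin r1), ∀ g ∈ Set.Ioi (0:ℝ),
      0 ≤ (g • Ω + Q⁻¹).det ^ (-(1:ℝ)/2) *
            (S1 + x ⬝ᵥ ((g • Ω + Q⁻¹)⁻¹).mulVec x) ^ (-a1) * pri g := by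
    intro x g hg
    have h1 := (aux_pd hΩ hQi (le_of_lt hg)).det_pos
    have h2 := hquad g (le_of_lt hg) x
    have h3 := hpri_nonneg g hg
    positivity
  have hint : ∀ x : EuclideanSpace ℝ (Fin r1), IntegrableOn (fun g : ℝ =>
      (g • Ω + Q⁻¹).det ^ (-(1:ℝ)/2) *
            (S1 + x ⬝ᵥ ((g • Ω + Q⁻¹)⁻¹).mulVec x) ^ (-a1) * pri g) (Set.Ioi 0) := by
    intro x
    refine Integrable.bdd_mul (c := d ^ (-(1:ℝ)/2) * S1 ^ (-a1)) hpri ?_ ?_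
    · refine ContinuousOn.aestronglyMeasurable ?_ measurableSet_Ioi
      refine ContinuousOn.mul ?_ ?_
      · exact aux_det_cont.continuousOn.rpow_const
          (fun g hg => Or.inl (aux_pd hΩ hQi (le_of_lt hg)).det_pos.ne')
      · refine ContinuousOn.rpow_const ?_
          (fun g hg => Or.inl (add_pos_of_pos_of_nonneg hS1p (hquad g (le_of_lt hg) x)).ne')
        refine continuousOn_const.add ?_
        have h1 := (aux_inv_cont hΩ hQi).mono Set.Ioi_subset_Ici_self
        rw [continuousOn_iff_continuous_domRestrict] at h1 ⊢
        exact continuous_const.dotProduct (h1.matrix_mulVec continuous_const)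
    · refine (ae_restrict_iff' measurableSet_Ioi).2 (Eventually.of_forall fun g hg => ?_)
      have h1 := (aux_pd hΩ hQi (le_of_lt hg)).det_pos
      have h2 := hquad g (le_of_lt hg) x
      rw [Real.norm_of_nonneg (by positivity)]
      refine mul_le_mul ?_ ?_ (by positivity) (by positivity)
      · exact Real.rpow_le_rpow_of_nonpos hd0 (hd g (le_of_lt hg)) (by norm_num)
      · exact Real.rpow_le_rpow_of_nonpos hS1p (by linarith) (by linarith)
  set δ : ℝ := a0 + 1 - r1 / 2 - α with hδ
  have hδp : 0 < δ := by rw [hδ, ha0]; linarith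
  set c : ℝ := C ^ (-(1:ℝ)/2) * (2:ℝ) ^ (-(r1:ℝ)/2) * (S1 + D) ^ (-a1) * (K * 2 ^ (-α)) * q ^ a0
    with hc
  have hcp : 0 < c := by positivity
  have hlim : Tendsto (fun x : EuclideanSpace ℝ (Fin r1) => c * (‖x‖ ^ 2) ^ δ)
      (comap (fun θhat : EuclideanSpace ℝ (Fin r1) => ‖θhat‖) atTop) atTop := by
    refine Tendsto.const_mul_atTop hcp ?_
    exact (tendsto_rpow_atTop hδp).comp ((tendsto_pow_atTop two_ne_zero).comp tendsto_comap)
  refine tendsto_atTop_mono' _ ?_ hlim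
  have hev : ∀ᶠ x : EuclideanSpace ℝ (Fin r1) in
      comap (fun θhat : EuclideanSpace ℝ (Fin r1) => ‖θhat‖) atTop, max M 1 ≤ ‖x‖ ^ 2 :=
    ((tendsto_pow_atTop two_ne_zero).comp tendsto_comap).eventually (eventually_ge_atTop _)
  filter_upwards [hev] with x hx
  rw [hBmix x]
  have hqx := hq x
  generalize htt : ‖x‖ ^ 2 = t at hx hqx ⊢
  have ht1 : 1 ≤ t := (le_max_right _ _).trans hx
  have htM : M ≤ t := (le_max_left _ _).trans hx
  have ht : 0 < t := by linarith
  set k : ℝ := (C * (2 * t) ^ r1) ^ (-(1:ℝ)/2) * (S1 + D) ^ (-a1) * (K * (2 * t) ^ (-α)) with hk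
  have hkp : 0 < k := by positivity
  have hsub : Set.Icc t (2 * t) ⊆ Set.Ioi (0:ℝ) := fun g hg => lt_of_lt_of_le ht hg.1
  have hlow : k * t ≤ ∫ g in Set.Ioi (0:ℝ), (g • Ω + Q⁻¹).det ^ (-(1:ℝ)/2) *
            (S1 + x ⬝ᵥ ((g • Ω + Q⁻¹)⁻¹).mulVec x) ^ (-a1) * pri g := by
    calc k * t = ∫ g in Set.Icc t (2 * t), k := by
          rw [setIntegral_const, Real.volume_real_Icc_of_le (by linarith), smul_eq_mul]; ring
      _ ≤ ∫ g in Set.Icc t (2 * t), (g • Ω + Q⁻¹).det ^ (-(1:ℝ)/2) *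
            (S1 + x ⬝ᵥ ((g • Ω + Q⁻¹)⁻¹).mulVec x) ^ (-a1) * pri g := by
          refine setIntegral_mono_on (integrableOn_const (by simp)) ((hint x).mono_set hsub)
            measurableSet_Icc (fun g hg => ?_)
          have hg0 : 0 < g := hsub hg
          have hg1 : 1 ≤ g := ht1.trans hg.1
          have h1 := (aux_pd hΩ hQi hg0.le).det_pos
          have h2 := hquad g hg0.le x
          have h3 : x ⬝ᵥ ((g • Ω + Q⁻¹)⁻¹).mulVec x ≤ D := by
            refine (hD g hg1 x).trans ?_
            rw [htt]
            have : t / g ≤ 1 := (div_le_one hg0).2 hg.1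
            nlinarith
          rw [hk]
          refine mul_le_mul (mul_le_mul ?_ ?_ (by positivity) (by positivity)) ?_
            (by positivity) (by positivity)
          · refine Real.rpow_le_rpow_of_nonpos h1 ((hC g hg1).trans ?_) (by norm_num)
            have := hg.2
            gcongr
          · exact Real.rpow_le_rpow_of_nonpos (add_pos_of_pos_of_nonneg hS1p h2) (by linarith) (by linarith)
          · refine le_trans ?_ (htail g (htM.trans hg.1))
            have h5 : (-α) ≤ 0 := by linarith
            exact mul_le_mul_of_nonneg_left (Real.rpow_le_rpow_of_nonpos hg0 hg.2 h5) hK.le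
      _ ≤ _ := setIntegral_mono_set (hint x)
          ((ae_restrict_iff' measurableSet_Ioi).2 (Eventually.of_forall (hnn x)))
          hsub.eventuallyLE
  have hden : (q * t) ^ a0 ≤ (S0 + x ⬝ᵥ Q.mulVec x) ^ a0 :=
    Real.rpow_le_rpow (by positivity) (by linarith) ha0p.le
  have hSp : 0 < S0 + x ⬝ᵥ Q.mulVec x := by
    have : 0 < q * t := by positivity
    linarith
  rw [Real.rpow_neg hSp.le, div_inv_eq_mul]
  refine le_trans (le_of_eq ?_) (mul_le_mul hlow hden (by positivity)
    (le_trans (by positivity) hlow))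
  have e1 : (C * (2 * t) ^ r1) ^ (-(1:ℝ)/2)
      = C ^ (-(1:ℝ)/2) * ((2:ℝ) ^ (-(r1:ℝ)/2) * t ^ (-(r1:ℝ)/2)) := by
    rw [Real.mul_rpow hC0.le (by positivity), ← Real.rpow_natCast, ← Real.rpow_mul (by positivity),
      Real.mul_rpow (by norm_num) ht.le]
    have : (r1:ℝ) * (-(1:ℝ)/2) = -(r1:ℝ)/2 := by ring
    rw [this]
  have e2 : t ^ δ = t ^ (-(r1:ℝ)/2) * t ^ (-α) * t * t ^ a0 := by
    nth_rewrite 4 [← Real.rpow_one t]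
    rw [← Real.rpow_add ht, ← Real.rpow_add ht, ← Real.rpow_add ht, hδ]
    congr 1; ring
  rw [hk, e1, e2, hc, Real.mul_rpow (by norm_num) ht.le, Real.mul_rpow hq0.le ht.le]
  ring
end

section
/- Consider the scale-mixture Bayes factor B10^mix(θ̂) defined below with ν0 < ν1. If there exist 0 < M' < ∞ and 0 < K' < ∞ such that π(g) ≤ K' g^{−α} for all g ≥ M', where α > 1, and α ≥ (n − r1 − r2 + ν0)/2 + 1, then B10^mix(θ̂) remains bounded as |θ̂| → ∞ (information inconsistency). -/
open MeasureTheory Filter Matrix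

lemma quad_bounds {r : ℕ} (K : Set ℝ) (hK : IsCompact K)
    (A : ℝ → Matrix (Fin r) (Fin r) ℝ) (hA : ContinuousOn A K) (hp : ∀ t ∈ K, (A t).PosDef) :
    ∃ c > 0, ∀ t ∈ K, ∀ θ : EuclideanSpace ℝ (Fin r),
      c * ‖θ‖ ^ 2 ≤ θ ⬝ᵥ (A t).mulVec θ ∧ θ ⬝ᵥ (A t).mulVec θ ≤ c⁻¹ * ‖θ‖ ^ 2 := by
  let f : ℝ × EuclideanSpace ℝ (Fin r) → ℝ := fun p => p.2 ⬝ᵥ (A p.1).mulVec p.2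
  let S := K ×ˢ Metric.sphere (0 : EuclideanSpace ℝ (Fin r)) 1
  have hS : IsCompact S := hK.prod (isCompact_sphere _ _)
  have hf : ContinuousOn f S := by
    have h1 : ContinuousOn (fun p : ℝ × EuclideanSpace ℝ (Fin r) => A p.1) S :=
      hA.comp continuous_fst.continuousOn (fun p hp => hp.1)
    have h1' : ∀ i j, ContinuousOn (fun p : ℝ × EuclideanSpace ℝ (Fin r) => A p.1 i j) S :=
      fun i j => (continuous_apply_apply (ρ := fun _ _ => ℝ) i j).comp_continuousOn h1
    simp only [f, dotProduct, mulVec]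
    refine continuousOn_finsetSum _ fun i _ => ContinuousOn.mul (by fun_prop) ?_
    refine continuousOn_finsetSum _ fun j _ => (h1' i j).mul (by fun_prop)
  have hpos : ∀ p ∈ S, 0 < f p := by
    rintro ⟨t, θ⟩ ⟨ht, hθ⟩
    have h0 : θ ≠ 0 := by
      rintro rfl
      simp at hθ
    have := (hp t ht).dotProduct_mulVec_pos (x := θ.ofLp) (by simpa using h0)
    simpa [f] using this
  obtain ⟨c, hc, hcb⟩ : ∃ c > 0, ∀ p ∈ S, c ≤ f p ∧ f p ≤ c⁻¹ := by
    rcases S.eq_empty_or_nonempty with hE | hE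
    · exact ⟨1, one_pos, by simp [hE]⟩
    · obtain ⟨x, hx, hxm⟩ := hS.exists_isMinOn hE hf
      obtain ⟨y, hy, hym⟩ := hS.exists_isMaxOn hE hf
      refine ⟨min (f x) (f y)⁻¹, lt_min (hpos x hx) (inv_pos.2 (hpos y hy)), fun p hp => ⟨?_, ?_⟩⟩
      · exact (min_le_left _ _).trans (hxm hp)
      · have h1 : f p ≤ f y := hym hp
        refine h1.trans ?_
        rw [le_inv_comm₀ (hpos y hy) (lt_min (hpos x hx) (inv_pos.2 (hpos y hy)))]
        exact min_le_right _ _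
  refine ⟨c, hc, fun t ht θ => ?_⟩
  by_cases h0 : θ = 0
  · simp [h0]
  have hn : 0 < ‖θ‖ := norm_pos_iff.2 h0
  have h2 := hcb (t, ‖θ‖⁻¹ • θ) ⟨ht, by simp [norm_smul, hn.ne']⟩
  have h3 : θ ⬝ᵥ (A t).mulVec θ = f (t, ‖θ‖⁻¹ • θ) * ‖θ‖ ^ 2 := by
    simp only [f, WithLp.ofLp_smul, mulVec_smul, smul_dotProduct, dotProduct_smul, smul_eq_mul]
    field_simp
  rw [h3]
  constructor <;> gcongr
  exacts [h2.1, h2.2]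

lemma pd_bounds {r : ℕ} (A B : Matrix (Fin r) (Fin r) ℝ) (hA : A.PosDef) (hB : B.PosDef) (R : ℝ) :
    ∃ c > 0, ∀ t ∈ Set.Icc 0 R, c ≤ (A + t • B).det ∧ ∀ θ : EuclideanSpace ℝ (Fin r),
      c * ‖θ‖ ^ 2 ≤ θ ⬝ᵥ ((A + t • B)⁻¹).mulVec θ := by
  have hp : ∀ t ∈ Set.Icc 0 R, (A + t • B).PosDef := fun t ht =>
    hA.add_posSemidef (hB.posSemidef.smul ht.1)
  have hc : Continuous (fun t : ℝ => A + t • B) := by fun_prop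
  have hd : Continuous (fun t : ℝ => (A + t • B).det) := hc.matrix_det
  obtain ⟨c, hc0, h⟩ := quad_bounds (Set.Icc 0 R) isCompact_Icc (fun t => (A + t • B)⁻¹) (by
    simp only [Matrix.inv_def, Ring.inverse_eq_inv']
    exact (hd.continuousOn.inv₀ fun t ht => (hp t ht).det_pos.ne').smul
      hc.matrix_adjugate.continuousOn) (fun t ht => (hp t ht).inv)
  obtain ⟨d, hd0, h'⟩ : ∃ d > 0, ∀ t ∈ Set.Icc 0 R, d ≤ (A + t • B).det := by
    rcases (Set.Icc 0 R).eq_empty_or_nonempty with hE | hE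
    · exact ⟨1, one_pos, by simp [hE]⟩
    · obtain ⟨x, hx, hxm⟩ := isCompact_Icc.exists_isMinOn hE hd.continuousOn
      exact ⟨_, (hp x hx).det_pos, fun t ht => hxm ht⟩
  refine ⟨min c d, lt_min hc0 hd0, fun t ht => ⟨(min_le_right _ _).trans (h' t ht), fun θ => ?_⟩⟩
  refine le_trans ?_ (h t ht θ).1
  gcongr
  exact min_le_left _ _

lemma tail_int (a b T : ℝ) (ha : 0 < a) (hab : a < b) (hT : 0 < T) :
    ∃ h : ℝ → ℝ, (∀ g, 0 < g → 0 ≤ h g) ∧ IntegrableOn h (Set.Ioi 0) ∧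
     (∫ g in Set.Ioi 0, h g = T ^ (-a) * (1 / (b - a) + 1 / a)) ∧
     (∀ g, 0 < g → g ≤ T → T ^ (-b) * g ^ (b - a - 1) ≤ h g) ∧
     (∀ g, T < g → g ^ (-a-1) ≤ h g) := by
  have i1 : IntegrableOn (fun g : ℝ => T ^ (-b) * g ^ (b - a - 1)) (Set.Ioc 0 T) := by
    rw [← intervalIntegrable_iff_integrableOn_Ioc_of_le hT.le]
    exact (intervalIntegral.intervalIntegrable_rpow' (by linarith)).const_mul _
  have i2 : IntegrableOn (fun g : ℝ => g ^ (-a - 1)) (Set.Ioi T) :=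
    integrableOn_Ioi_rpow_of_lt (by linarith) hT
  let h : ℝ → ℝ := fun g => if g ≤ T then T ^ (-b) * g ^ (b - a - 1) else g ^ (-a-1)
  have e1 : Set.EqOn (fun g : ℝ => T ^ (-b) * g ^ (b - a - 1)) h (Set.Ioc 0 T) := fun g hg => by
    simp [h, hg.2]
  have e2 : Set.EqOn (fun g : ℝ => g ^ (-a - 1)) h (Set.Ioi T) := fun g hg => by
    simp [h, not_le.2 (show T < g from hg)]
  have j1 : IntegrableOn h (Set.Ioc 0 T) := i1.congr_fun e1 measurableSet_Ioc
  have j2 : IntegrableOn h (Set.Ioi T) := i2.congr_fun e2 measurableSet_Ioi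
  refine ⟨h, ?_, ?_, ?_, ?_, ?_⟩
  · intro g hg
    simp only [h]
    split_ifs <;> positivity
  · rw [← Set.Ioc_union_Ioi_eq_Ioi hT.le]
    exact j1.union j2
  · rw [← Set.Ioc_union_Ioi_eq_Ioi hT.le, setIntegral_union (Set.Ioc_disjoint_Ioi le_rfl)
      measurableSet_Ioi j1 j2, ← setIntegral_congr_fun measurableSet_Ioc e1,
      ← setIntegral_congr_fun measurableSet_Ioi e2, integral_Ioi_rpow_of_lt (by linarith) hT,
      ← intervalIntegral.integral_of_le hT.le, intervalIntegral.integral_const_mul,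
      integral_rpow (Or.inl (by linarith))]
    have h1 : T ^ (-a) = T ^ (-b) * T ^ (b - a) := by rw [← Real.rpow_add hT]; congr 1; ring
    rw [show b - a - 1 + 1 = b - a by ring, show -a - 1 + 1 = -a by ring,
      Real.zero_rpow (by linarith), neg_div_neg_eq, mul_add, mul_one_div, mul_one_div, sub_zero]
    congr 1
    rw [h1, mul_div_assoc]
  · intro g hg hgT
    simp [h, hgT]
  · intro g hg
    simp [h, not_le.2 hg]

theorem boundedpart
    (n r1 r2 : ℕ) 
    (Q Ω : Matrix (Fin r1) (Fin r1) ℝ) (hQ : Q.PosDef) (hΩ : Ω.PosDef)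
    (a0 a1 : ℝ) (c0 c1 : ℝ) (hc0 : 0 < c0) (hc1 : 0 < c1)
    (hdf : 0 < a1) (hν : a0 < a1)
    (pri : ℝ → ℝ) 
    (hpri_nonneg : ∀ g ∈ Set.Ioi (0:ℝ), 0 ≤ pri g)
    (hpri_int : ∫ g in Set.Ioi (0:ℝ), pri g = 1)
    (M' K' α : ℝ) (hM' : 0 < M') (hK' : 0 < K') 
    (htail : ∀ g : ℝ, M' ≤ g → pri g ≤ K' * g ^ (-α))
    (hαbound : a0 - r1 / 2 + 1 ≤ α) :
    ∃ B : ℝ, ∀ θhat : EuclideanSpace ℝ (Fin r1), 1 ≤ ‖θhat‖ → 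
      (∫ g in Set.Ioi (0:ℝ),
          (g • Ω + Q⁻¹).det ^ (-(1:ℝ)/2) *
            (c1 + θhat ⬝ᵥ ((g • Ω + Q⁻¹)⁻¹).mulVec θhat)
              ^ (-a1) * pri g) /
        (c0 + θhat ⬝ᵥ Q.mulVec θhat)
          ^ (-a0) ≤ B := by
  have hpi : IntegrableOn pri (Set.Ioi 0) := by
    by_contra h
    rw [integral_undef h] at hpri_int
    exact zero_ne_one hpri_int
  obtain ⟨c, hc, hlow⟩ := pd_bounds Q⁻¹ Ω hQ.inv hΩ M'
  obtain ⟨d, hd, hup⟩ := pd_bounds Ω Q⁻¹ hΩ hQ.inv M'⁻¹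
  obtain ⟨q, hq, hqb⟩ := quad_bounds {(0:ℝ)} isCompact_singleton (fun _ => Q) continuousOn_const
    (fun _ _ => hQ)
  -- facts on g
  have hPD : ∀ g : ℝ, 0 < g → (g • Ω + Q⁻¹).PosDef := fun g hg => (hΩ.smul hg).add hQ.inv
  have hqf : ∀ g : ℝ, 0 < g → ∀ θ : EuclideanSpace ℝ (Fin r1),
      0 ≤ θ ⬝ᵥ ((g • Ω + Q⁻¹)⁻¹).mulVec θ := fun g hg θ => by
    simpa using (hPD g hg).inv.posSemidef.dotProduct_mulVec_nonneg θ.ofLp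
  have low : ∀ g : ℝ, 0 < g → g ≤ M' → c ≤ (g • Ω + Q⁻¹).det ∧
      ∀ θ : EuclideanSpace ℝ (Fin r1), c * ‖θ‖ ^ 2 ≤ θ ⬝ᵥ ((g • Ω + Q⁻¹)⁻¹).mulVec θ := by
    intro g h1 h2
    rw [add_comm]
    exact hlow g ⟨h1.le, h2⟩
  have up : ∀ g : ℝ, M' ≤ g → d * g ^ (r1 : ℝ) ≤ (g • Ω + Q⁻¹).det ∧
      ∀ θ : EuclideanSpace ℝ (Fin r1),
        d * (‖θ‖ ^ 2 / g) ≤ θ ⬝ᵥ ((g • Ω + Q⁻¹)⁻¹).mulVec θ := by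
    intro g h1
    have hg : 0 < g := hM'.trans_le h1
    have e : g • Ω + Q⁻¹ = g • (Ω + g⁻¹ • Q⁻¹) := by
      rw [smul_add, smul_smul, mul_inv_cancel₀ hg.ne', one_smul]
    obtain ⟨u1, u2⟩ := hup g⁻¹ ⟨by positivity, by gcongr⟩
    have hdet : (Ω + g⁻¹ • Q⁻¹).det ≠ 0 := (hd.trans_le u1).ne'
    constructor
    · rw [e, det_smul, Fintype.card_fin, Real.rpow_natCast, mul_comm]
      gcongr
    · intro θ
      have e2 : (g • (Ω + g⁻¹ • Q⁻¹))⁻¹ = g⁻¹ • (Ω + g⁻¹ • Q⁻¹)⁻¹ := by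
        have := Matrix.inv_smul' (Ω + g⁻¹ • Q⁻¹) (Units.mk0 g hg.ne') (isUnit_iff_ne_zero.2 hdet)
        exact this
      rw [e, e2, smul_mulVec, dotProduct_smul, smul_eq_mul]
      calc _ = g⁻¹ * (d * ‖θ‖ ^ 2) := by ring
        _ ≤ _ := by gcongr; exact u2 θ
  have hα' : ∀ g : ℝ, M' ≤ g → pri g ≤ K' * (M' ^ (a0 - r1/2 + 1 - α) * g ^ (-(a0 - r1/2 + 1))) := by
    intro g h1
    have hg : 0 < g := hM'.trans_le h1
    refine (htail g h1).trans ?_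
    gcongr
    have : g ^ (-α) = g ^ (a0 - r1/2 + 1 - α) * g ^ (-(a0 - r1/2 + 1)) := by
      rw [← Real.rpow_add hg]; congr 1; ring
    rw [this]
    gcongr ?_ * _
    exact Real.rpow_le_rpow_of_nonpos hM' h1 (by linarith)
  have hT : ∀ θ : EuclideanSpace ℝ (Fin r1), 0 ≤ θ ⬝ᵥ Q.mulVec θ := fun θ => by
    simpa using hQ.posSemidef.dotProduct_mulVec_nonneg θ.ofLp
  rcases le_or_gt a0 0 with h0 | h0
  · -- trivial case
    obtain ⟨e, he, hdete⟩ : ∃ e > 0, ∀ g : ℝ, 0 < g → e ≤ (g • Ω + Q⁻¹).det := by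
      refine ⟨min c (d * M' ^ (r1 : ℝ)), by positivity, fun g hg => ?_⟩
      rcases le_total g M' with h | h
      · exact (min_le_left _ _).trans (low g hg h).1
      · refine (min_le_right _ _).trans (le_trans ?_ (up g h).1)
        gcongr
    refine ⟨(e ^ (-(1:ℝ)/2) * c1 ^ (-a1)) * c0 ^ a0, fun θ hθ => ?_⟩
    rw [Real.rpow_neg (by linarith [hT θ]), div_inv_eq_mul]
    have h1 : ∫ g in Set.Ioi (0:ℝ), (g • Ω + Q⁻¹).det ^ (-(1:ℝ)/2) *
            (c1 + θ ⬝ᵥ ((g • Ω + Q⁻¹)⁻¹).mulVec θ) ^ (-a1) * pri g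
        ≤ ∫ g in Set.Ioi (0:ℝ), (e ^ (-(1:ℝ)/2) * c1 ^ (-a1)) * pri g := by
      refine integral_mono_of_nonneg ?_ (hpi.const_mul _) ?_
      · filter_upwards [ae_restrict_mem measurableSet_Ioi] with g hg
        have := hqf g hg θ
        have := hpri_nonneg g hg
        have := (hPD g hg).det_pos
        simp only [Pi.zero_apply]
        positivity
      · filter_upwards [ae_restrict_mem measurableSet_Ioi] with g hg
        have := hqf g hg θ
        have := hpri_nonneg g hg
        have := (hPD g hg).det_pos
        gcongr ?_ * ?_ * _
        · exact Real.rpow_le_rpow_of_nonpos he (hdete g hg) (by norm_num)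
        · exact Real.rpow_le_rpow_of_nonpos hc1 (by linarith) (by linarith)
    rw [integral_const_mul, hpri_int, mul_one] at h1
    have h2 := hT θ
    gcongr ?_ * ?_
    exact Real.rpow_le_rpow_of_nonpos hc0 (by linarith) h0
  · set C1 := c ^ (-(1:ℝ)/2) * c ^ (-a1) with hC1
    set C2 := d ^ (-(1:ℝ)/2) * (min d c1) ^ (-a1) * (K' * M' ^ (a0 - r1/2 + 1 - α)) with hC2
    have hmin : 0 < min d c1 := lt_min hd hc1
    refine ⟨(C1 + C2 * (1 / (a1 - a0) + 1 / a0)) * (c0 + q⁻¹) ^ a0, fun θ hθ => ?_⟩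
    set T := ‖θ‖ ^ 2 with hTd
    have hT1 : 1 ≤ T := one_le_pow₀ hθ
    have hT0 : 0 < T := by linarith
    rw [Real.rpow_neg (by linarith [hT θ]), div_inv_eq_mul]
    obtain ⟨h, hh0, hhi, hhv, hh1, hh2⟩ := tail_int a0 a1 T h0 hν hT0
    have h1 : ∫ g in Set.Ioi (0:ℝ), (g • Ω + Q⁻¹).det ^ (-(1:ℝ)/2) *
            (c1 + θ ⬝ᵥ ((g • Ω + Q⁻¹)⁻¹).mulVec θ) ^ (-a1) * pri g
        ≤ ∫ g in Set.Ioi (0:ℝ), ((C1 * T ^ (-a0)) * pri g + C2 * h g) := by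
      refine integral_mono_of_nonneg ?_ ((hpi.const_mul _).add (hhi.const_mul _)) ?_
      · filter_upwards [ae_restrict_mem measurableSet_Ioi] with g hg
        have := hqf g hg θ
        have := hpri_nonneg g hg
        have := (hPD g hg).det_pos
        simp only [Pi.zero_apply]
        positivity
      · filter_upwards [ae_restrict_mem measurableSet_Ioi] with g hg
        have hg0 : 0 < g := hg
        have q1 := hqf g hg θ
        have q2 := hpri_nonneg g hg
        have q3 := (hPD g hg).det_pos
        have q4 := hh0 g hg
        rcases le_total g M' with hgM | hgM
        · obtain ⟨l1, l2⟩ := low g hg hgM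
          have : 0 ≤ C2 * h g := by positivity
          refine le_trans ?_ (le_add_of_nonneg_right this)
          rw [hC1, mul_assoc (c ^ (-(1:ℝ)/2))]
          gcongr ?_ * ?_ * _
          · exact Real.rpow_le_rpow_of_nonpos hc l1 (by norm_num)
          · calc _ ≤ (c * T) ^ (-a1) :=
                  Real.rpow_le_rpow_of_nonpos (by positivity) (by linarith [l2 θ]) (by linarith)
              _ = c ^ (-a1) * T ^ (-a1) := Real.mul_rpow hc.le hT0.le
              _ ≤ _ := by
                gcongr ?_ * ?_
                exact Real.rpow_le_rpow_of_exponent_le hT1 (by linarith)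
        · obtain ⟨l1, l2⟩ := up g hgM
          have : 0 ≤ C1 * T ^ (-a0) * pri g := by positivity
          refine le_trans ?_ (le_add_of_nonneg_left this)
          have s1 : (g • Ω + Q⁻¹).det ^ (-(1:ℝ)/2) ≤ d ^ (-(1:ℝ)/2) * g ^ (-(r1:ℝ)/2) := by
            calc _ ≤ (d * g ^ (r1:ℝ)) ^ (-(1:ℝ)/2) :=
                  Real.rpow_le_rpow_of_nonpos (by positivity) l1 (by norm_num)
              _ = _ := by
                rw [Real.mul_rpow hd.le (by positivity), ← Real.rpow_mul hg0.le]
                congr 2; ring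
          have s2 := hα' g hgM
          have s3 : (c1 + θ ⬝ᵥ ((g • Ω + Q⁻¹)⁻¹).mulVec θ) ^ (-a1) * g ^ (-a0 - 1) ≤
              (min d c1) ^ (-a1) * h g := by
            rcases le_or_gt g T with hgT | hgT
            · calc _ ≤ (min d c1 * (T / g)) ^ (-a1) * g ^ (-a0 - 1) := by
                    gcongr ?_ * _
                    refine Real.rpow_le_rpow_of_nonpos (by positivity) ?_ (by linarith)
                    have : min d c1 * (T / g) ≤ d * (T / g) := by
                      gcongr; exact min_le_left _ _
                    linarith [l2 θ]
                _ = (min d c1) ^ (-a1) * (T ^ (-a1) * g ^ (a1 - a0 - 1)) := by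
                    rw [Real.mul_rpow hmin.le (by positivity), Real.div_rpow hT0.le hg0.le,
                      show a1 - a0 - 1 = (-a0 - 1) - (-a1) by ring, Real.rpow_sub hg0 (-a0-1)]
                    ring
                _ ≤ _ := by gcongr; exact hh1 g hg0 hgT
            · gcongr ?_ * ?_
              · refine Real.rpow_le_rpow_of_nonpos hmin ?_ (by linarith)
                linarith [min_le_right d c1]
              · exact hh2 g hgT
          calc _ ≤ (d ^ (-(1:ℝ)/2) * g ^ (-(r1:ℝ)/2)) *
                (c1 + θ ⬝ᵥ ((g • Ω + Q⁻¹)⁻¹).mulVec θ) ^ (-a1) *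
                (K' * (M' ^ (a0 - r1/2 + 1 - α) * g ^ (-(a0 - r1/2 + 1)))) := by
                gcongr
            _ = d ^ (-(1:ℝ)/2) * (K' * M' ^ (a0 - r1/2 + 1 - α)) *
                ((c1 + θ ⬝ᵥ ((g • Ω + Q⁻¹)⁻¹).mulVec θ) ^ (-a1) * g ^ (-a0 - 1)) := by
                rw [show -a0 - 1 = -(r1:ℝ)/2 + (-(a0 - r1/2 + 1)) by ring, Real.rpow_add hg0]
                ring
            _ ≤ d ^ (-(1:ℝ)/2) * (K' * M' ^ (a0 - r1/2 + 1 - α)) *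
                ((min d c1) ^ (-a1) * h g) := by gcongr
            _ = _ := by rw [hC2]; ring
    rw [integral_add (hpi.const_mul _) (hhi.const_mul _), integral_const_mul, integral_const_mul,
      hpri_int, hhv] at h1
    have h2 : (c0 + θ ⬝ᵥ Q.mulVec θ) ^ a0 ≤ (c0 + q⁻¹) ^ a0 * T ^ a0 := by
      rw [← Real.mul_rpow (by positivity) hT0.le]
      have := hT θ
      refine Real.rpow_le_rpow (by positivity) ?_ h0.le
      have := (hqb 0 rfl θ).2
      nlinarith
    have h3 : 0 < a1 - a0 := by linarith
    have h4 := hT θ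
    calc _ ≤ (C1 * T ^ (-a0) * 1 + C2 * (T ^ (-a0) * (1 / (a1 - a0) + 1 / a0))) *
          ((c0 + q⁻¹) ^ a0 * T ^ a0) := by gcongr
      _ = (C1 + C2 * (1 / (a1 - a0) + 1 / a0)) * (c0 + q⁻¹) ^ a0 * (T ^ (-a0) * T ^ a0) := by ring
      _ = _ := by rw [← Real.rpow_add hT0]; simp

/-- ν0 < ν1, polynomial upper tail π(g) ≤ K' g^{−α} for g ≥ M' with α > 1 and
α ≥ (n−r1−r2+ν0)/2 + 1 implies information inconsistency: B10^mix remains bounded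
as |θ̂| → ∞. -/
theorem mixture_bayes_factor_inconsistent_of_polynomial_upper_tail
    (n r1 r2 : ℕ) (hn : 1 ≤ n) (hr1 : 1 ≤ r1)
    (Q Ω : Matrix (Fin r1) (Fin r1) ℝ) (hQ : Q.PosDef) (hΩ : Ω.PosDef)
    (ν0 ν1 : ℝ) (hν0 : 0 ≤ ν0) (hν1 : 0 ≤ ν1)
    (hdf : 0 < (n : ℝ) - r1 - r2 + ν1)
    (s0sq s1sq : ℝ) (hs0 : 0 < s0sq) (hs1 : 0 < s1sq)
    (sysq : ℝ) (hsy : 0 < sysq)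
    (pri : ℝ → ℝ) (hpri_meas : Measurable pri)
    (hpri_nonneg : ∀ g ∈ Set.Ioi (0:ℝ), 0 ≤ pri g)
    (hpri_int : ∫ g in Set.Ioi (0:ℝ), pri g = 1)
    (Bmix : EuclideanSpace ℝ (Fin r1) → ℝ)
    (hBmix : ∀ θhat : EuclideanSpace ℝ (Fin r1),
      Bmix θhat =
        (∫ g in Set.Ioi (0:ℝ),
          (g • Ω + Q⁻¹).det ^ (-(1:ℝ)/2) *
            (ν1 * s1sq + sysq + θhat ⬝ᵥ ((g • Ω + Q⁻¹)⁻¹).mulVec θhat)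
              ^ (-(((n:ℝ) - r2 + ν1) / 2)) * pri g) /
        (ν0 * s0sq + sysq + θhat ⬝ᵥ Q.mulVec θhat)
          ^ (-(((n:ℝ) - r2 + ν0) / 2)))
    (hν : ν0 < ν1)
    (M' K' α : ℝ) (hM' : 0 < M') (hK' : 0 < K') (hα : 1 < α)
    (htail : ∀ g : ℝ, M' ≤ g → pri g ≤ K' * g ^ (-α))
    (hαbound : ((n:ℝ) - r1 - r2 + ν0) / 2 + 1 ≤ α) :
    (∃ B : ℝ, ∀ᶠ θhat in comap (fun θhat : EuclideanSpace ℝ (Fin r1) => ‖θhat‖) atTop,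
        Bmix θhat ≤ B) ∧
    ¬ Tendsto Bmix (comap (fun θhat : EuclideanSpace ℝ (Fin r1) => ‖θhat‖) atTop) atTop := by
  have hr : (0:ℝ) ≤ r1 := Nat.cast_nonneg _
  obtain ⟨B, hB⟩ := boundedpart n r1 r2 Q Ω hQ hΩ (((n:ℝ) - r2 + ν0) / 2) (((n:ℝ) - r2 + ν1) / 2)
    (ν0 * s0sq + sysq) (ν1 * s1sq + sysq) (by positivity) (by positivity) (by linarith)
    (by linarith) pri hpri_nonneg hpri_int M' K' α hM' hK' htail (by linarith)
  have hev : ∀ᶠ θhat in comap (fun θhat : EuclideanSpace ℝ (Fin r1) => ‖θhat‖) atTop,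
      Bmix θhat ≤ B := by
    filter_upwards [preimage_mem_comap (Ici_mem_atTop (1:ℝ))] with θ hθ
    rw [hBmix]
    exact hB θ hθ
  refine ⟨⟨B, hev⟩, fun ht => ?_⟩
  have : Nonempty (Fin r1) := ⟨⟨0, hr1⟩⟩
  have hne : (comap (fun θhat : EuclideanSpace ℝ (Fin r1) => ‖θhat‖) atTop).NeBot := by
    rw [comap_norm_atTop]
    infer_instance
  obtain ⟨θ, h1, h2⟩ := (hev.and (ht.eventually_gt_atTop B)).exists
  linarith
end

section
/- Let A and Ω be positive definite r×r real matrices, let c > 0 and m > 0 be real constants, and let φ_Ω denote the N(0, Ω) density on ℝ^r. Then lim_{|θ̂|→∞} (θ̂ᵀAθ̂)^{m/2} · ∫_{ℝ^r} (c + (θ − θ̂)ᵀA(θ − θ̂))^{−m/2} φ_Ω(θ) dθ = 1. -/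
open MeasureTheory Filter Matrix

lemma factor_posDef {r : ℕ} (A : Matrix (Fin r) (Fin r) ℝ) (hA : A.PosDef) :
    ∃ L : EuclideanSpace ℝ (Fin r) ≃L[ℝ] EuclideanSpace ℝ (Fin r),
      (∀ x : EuclideanSpace ℝ (Fin r), x ⬝ᵥ A.mulVec x = ‖L x‖ ^ 2) ∧
      (LinearMap.det (L : EuclideanSpace ℝ (Fin r) →ₗ[ℝ] EuclideanSpace ℝ (Fin r))) ^ 2 = A.det := by
  obtain ⟨B, hB⟩ : ∃ B : Matrix (Fin r) (Fin r) ℝ, A = Bᴴ * B := by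
    open scoped MatrixOrder in
    exact CStarAlgebra.nonneg_iff_eq_star_mul_self.mp hA.posSemidef.nonneg
  have hdet : B.det ^ 2 = A.det := by
    rw [hB, det_mul, det_conjTranspose]; simp [sq]
  have hBdet : B.det ≠ 0 := by
    intro h
    have := hA.det_pos
    rw [← hdet, h] at this
    simp at this
  have hd : LinearMap.det (Matrix.toEuclideanLin B) = B.det := by
    rw [Matrix.toEuclideanLin_eq_toLin_orthonormal, LinearMap.det_toLin]
  let e := LinearMap.equivOfDetNeZero (Matrix.toEuclideanLin B) (by rw [hd]; exact hBdet)
  have he : (e : EuclideanSpace ℝ (Fin r) →ₗ[ℝ] EuclideanSpace ℝ (Fin r)) = Matrix.toEuclideanLin B := rfl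
  refine ⟨e.toContinuousLinearEquiv, ?_, ?_⟩
  · intro x
    have : e.toContinuousLinearEquiv x = Matrix.toEuclideanLin B x := rfl
    rw [this, EuclideanSpace.real_norm_sq_eq, hB, ← Matrix.mulVec_mulVec, Matrix.dotProduct_mulVec]
    simp [Matrix.vecMul_transpose, dotProduct, sq]
  · have : ((e.toContinuousLinearEquiv : EuclideanSpace ℝ (Fin r) ≃L[ℝ] EuclideanSpace ℝ (Fin r)) : EuclideanSpace ℝ (Fin r) →ₗ[ℝ] EuclideanSpace ℝ (Fin r)) = Matrix.toEuclideanLin B := rfl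
    rw [this, hd, hdet]

lemma gauss_int {r : ℕ} (L : EuclideanSpace ℝ (Fin r) ≃L[ℝ] EuclideanSpace ℝ (Fin r)) {b : ℝ} (hb : 0 < b) :
    ∫ x, Real.exp (-b * ‖L x‖ ^ 2) =
     |(LinearMap.det (L : EuclideanSpace ℝ (Fin r) →ₗ[ℝ] EuclideanSpace ℝ (Fin r)))|⁻¹ * (Real.pi / b) ^ ((r:ℝ)/2) := by
  have hdet : LinearMap.det (L : EuclideanSpace ℝ (Fin r) →ₗ[ℝ] EuclideanSpace ℝ (Fin r)) ≠ 0 :=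
    (LinearEquiv.isUnit_det' L.toLinearEquiv).ne_zero
  have h1 := Measure.map_linearMap_addHaar_eq_smul_addHaar (volume : Measure (EuclideanSpace ℝ (Fin r))) hdet
  have h2 := L.toHomeomorph.measurableEmbedding.integral_map (μ := volume) (fun y => Real.exp (-b * ‖y‖ ^ 2))
  have h3 : Measure.map (L.toHomeomorph) (volume : Measure (EuclideanSpace ℝ (Fin r))) = _ := h1
  rw [h3, integral_smul_measure, GaussianFourier.integral_rexp_neg_mul_sq_norm hb] at h2
  have h4 : ∀ x, L.toHomeomorph x = L x := fun _ => rfl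
  simp only [h4] at h2
  rw [← h2, ENNReal.toReal_ofReal (abs_nonneg _), abs_inv]
  simp

lemma gauss_integrable {r : ℕ} (L : EuclideanSpace ℝ (Fin r) ≃L[ℝ] EuclideanSpace ℝ (Fin r)) {b : ℝ} (hb : 0 < b) :
    Integrable (fun x => Real.exp (-b * ‖L x‖ ^ 2)) := by
  have hdet : LinearMap.det (L : EuclideanSpace ℝ (Fin r) →ₗ[ℝ] EuclideanSpace ℝ (Fin r)) ≠ 0 :=
    (LinearEquiv.isUnit_det' L.toLinearEquiv).ne_zero
  apply Integrable.of_integral_ne_zero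
  rw [gauss_int L hb]
  have := Real.pi_pos
  positivity

lemma rpow_le_exp {p ε u : ℝ} (hp : 0 < p) (hε : 0 < ε) (hu : 0 ≤ u) :
    u ^ p ≤ (p / ε) ^ p * Real.exp (ε * u) := by
  have h : u ≤ (p / ε) * Real.exp (ε * u / p) := by
    have := Real.add_one_le_exp (ε * u / p)
    calc u = (p / ε) * (ε * u / p) := by field_simp
      _ ≤ _ := by gcongr; linarith
  calc u ^ p ≤ ((p / ε) * Real.exp (ε * u / p)) ^ p := by gcongr
    _ = _ := by
      rw [Real.mul_rpow (by positivity) (by positivity), ← Real.exp_mul]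
      congr 2; field_simp

lemma ratio_tendsto {V : Type*} [NormedAddCommGroup V] {ι : Type*} {l : Filter ι} (u : ι → V) (v : V) (c : ℝ)
    (hu : Tendsto (fun i => ‖u i‖) l atTop) :
    Tendsto (fun i => ‖u i‖ ^ 2 / (c + ‖v - u i‖ ^ 2)) l (nhds 1) := by
  have h0 : Tendsto (fun i => ‖v - u i‖ / ‖u i‖) l (nhds 1) := by
    rw [tendsto_iff_dist_tendsto_zero]
    refine squeeze_zero' (g := fun i => ‖v‖ / ‖u i‖) (Eventually.of_forall fun _ => dist_nonneg) ?_ (hu.const_div_atTop _)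
    filter_upwards [hu.eventually_gt_atTop 0] with i hi
    rw [Real.dist_eq, div_sub_one hi.ne', abs_div, abs_of_pos hi]
    gcongr
    have := abs_norm_sub_norm_le (v - u i) (-u i)
    simpa using this
  have h1 : Tendsto (fun i => c / ‖u i‖ ^ 2) l (nhds 0) :=
    ((tendsto_pow_atTop two_ne_zero).comp hu).const_div_atTop c
  have h2 := (h1.add (h0.pow 2)).inv₀ (by norm_num)
  have h3 : ((0:ℝ) + 1 ^ 2)⁻¹ = 1 := by norm_num
  rw [h3] at h2
  refine h2.congr' ?_
  filter_upwards [hu.eventually_gt_atTop 0] with i hi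
  rw [div_pow, ← add_div, inv_div]

/-- For positive definite A, Ω and c, m > 0,
(θ̂ᵀAθ̂)^{m/2} ∫ (c + (θ−θ̂)ᵀA(θ−θ̂))^{−m/2} φ_Ω(θ) dθ → 1 as the Euclidean norm |θ̂| → ∞,
where φ_Ω is the centered N(0, Ω) density on ℝ^r. -/
theorem gaussian_weighted_inverse_power_integral_limit
    (r : ℕ) (hr : 1 ≤ r)
    (A Ω : Matrix (Fin r) (Fin r) ℝ) (hA : A.PosDef) (hΩ : Ω.PosDef)
    (c m : ℝ) (hc : 0 < c) (hm : 0 < m)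
    (φ : EuclideanSpace ℝ (Fin r) → ℝ)
    (hφ : ∀ θ : EuclideanSpace ℝ (Fin r),
      φ θ = (2 * Real.pi) ^ (-(r:ℝ)/2) * Ω.det ^ (-(1:ℝ)/2) *
        Real.exp (-(θ ⬝ᵥ (Ω⁻¹).mulVec θ) / 2)) :
    Tendsto
      (fun θhat : EuclideanSpace ℝ (Fin r) =>
        (θhat ⬝ᵥ A.mulVec θhat) ^ (m / 2) *
          ∫ θ : EuclideanSpace ℝ (Fin r),
            (c + (θ - θhat) ⬝ᵥ A.mulVec (θ - θhat)) ^ (-(m / 2)) * φ θ)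
      (comap (fun θhat : EuclideanSpace ℝ (Fin r) => ‖θhat‖) atTop) (nhds 1) := by
  obtain ⟨S, hS, -⟩ := factor_posDef A hA
  obtain ⟨T, hT, hTdet⟩ := factor_posDef _ hΩ.inv
  have hpi := Real.pi_pos
  have hΩd := hΩ.det_pos
  set D : ℝ := (2 * Real.pi) ^ (-(r:ℝ)/2) * Ω.det ^ (-(1:ℝ)/2) with hD
  have hD0 : 0 < D := by positivity
  have hφ' : ∀ θ, φ θ = D * Real.exp (-(1/2) * ‖T θ‖ ^ 2) := by
    intro θ
    rw [hφ, hT]; congr 2; ring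
  have hφint : ∫ θ, φ θ = 1 := by
    simp_rw [hφ']
    rw [integral_const_mul, gauss_int T (by norm_num), hD]
    have e1 : |(LinearMap.det (T : EuclideanSpace ℝ (Fin r) →ₗ[ℝ] EuclideanSpace ℝ (Fin r)))|⁻¹ = Ω.det ^ ((1:ℝ)/2) := by
      rw [← Real.sqrt_sq_eq_abs, hTdet, Matrix.det_nonsing_inv, Ring.inverse_eq_inv', Real.sqrt_inv, inv_inv, Real.sqrt_eq_rpow]
    have e2 : Real.pi / (1/2) = 2 * Real.pi := by ring
    rw [e1, e2, neg_div, neg_div, Real.rpow_neg (by positivity), Real.rpow_neg (by positivity)]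
    have : (2 * Real.pi) ^ ((r:ℝ)/2) ≠ 0 := by positivity
    have : Ω.det ^ ((1:ℝ)/2) ≠ 0 := by positivity
    field_simp
  have hsub : ∀ x y : EuclideanSpace ℝ (Fin r),
      (x - y) ⬝ᵥ A.mulVec (x - y) = ‖S x - S y‖ ^ 2 := by
    intro x y
    rw [← map_sub, ← hS (x - y)]; rfl
  have hStend : Tendsto (fun θhat => ‖S θhat‖)
      (comap (fun θhat : EuclideanSpace ℝ (Fin r) => ‖θhat‖) atTop) atTop := by
    rw [comap_norm_atTop, tendsto_norm_atTop_iff_cobounded, Metric.cobounded_eq_cocompact]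
    exact S.toHomeomorph.isClosedEmbedding.tendsto_cocompact
  obtain ⟨K, hK0, hK⟩ : ∃ K : ℝ, 0 < K ∧ ∀ x, ‖S x‖ ≤ K * ‖T x‖ := by
    let M : EuclideanSpace ℝ (Fin r) →L[ℝ] EuclideanSpace ℝ (Fin r) := 
      (S : EuclideanSpace ℝ (Fin r) →L[ℝ] EuclideanSpace ℝ (Fin r)).comp (T.symm : EuclideanSpace ℝ (Fin r) →L[ℝ] EuclideanSpace ℝ (Fin r))
    refine ⟨‖M‖ + 1, by positivity, fun x => ?_⟩
    have := M.le_opNorm (T x)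
    simp only [M, ContinuousLinearMap.comp_apply, ContinuousLinearEquiv.coe_coe, ContinuousLinearEquiv.symm_apply_apply] at this
    nlinarith [norm_nonneg (T x)]
  have hp : 0 < m / 2 := by positivity
  set p := m / 2
  have key : Tendsto (fun θhat : EuclideanSpace ℝ (Fin r) =>
      ∫ θ : EuclideanSpace ℝ (Fin r), (‖S θhat‖ ^ 2 / (c + ‖S θ - S θhat‖ ^ 2)) ^ p * φ θ)
      (comap (fun θhat : EuclideanSpace ℝ (Fin r) => ‖θhat‖) atTop) (nhds (∫ θ, φ θ)) := by
    set b : ℝ := 2 * K ^ 2 / c with hb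
    have hb0 : 0 < b := by positivity
    refine tendsto_integral_filter_of_dominated_convergence
      (fun θ => ((p / (1 / (4 * b))) ^ p * Real.exp (2 / (4 * b)) * D) * Real.exp (-(1/4) * ‖T θ‖ ^ 2)) ?_ ?_ ?_ ?_
    · refine Eventually.of_forall fun θhat => Continuous.aestronglyMeasurable ?_
      simp_rw [hφ']
      refine Continuous.mul (Continuous.rpow_const ?_ fun _ => Or.inr hp.le) (by fun_prop)
      exact continuous_const.div (by fun_prop) fun x => by positivity
    · refine Eventually.of_forall fun θhat => Eventually.of_forall fun θ => ?_
      rw [hφ', Real.norm_of_nonneg (by positivity)]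
      have h1 : ‖S θhat‖ ^ 2 / (c + ‖S θ - S θhat‖ ^ 2) ≤ 2 + b * ‖T θ‖ ^ 2 := by
        rw [div_le_iff₀ (by positivity)]
        have t1 : ‖S θhat‖ ≤ ‖S θ‖ + ‖S θ - S θhat‖ := by
          have := norm_sub_le (S θ) (S θ - S θhat)
          simpa using this
        have t2 : ‖S θhat‖ ^ 2 ≤ 2 * ‖S θ‖ ^ 2 + 2 * ‖S θ - S θhat‖ ^ 2 := by
          nlinarith [norm_nonneg (S θhat), sq_nonneg (‖S θ‖ - ‖S θ - S θhat‖)]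
        have t3 : ‖S θ‖ ^ 2 ≤ K ^ 2 * ‖T θ‖ ^ 2 := by
          rw [← mul_pow]; gcongr; exact hK θ
        have t4 : b * c = 2 * K ^ 2 := by rw [hb]; field_simp
        have t5 : 0 ≤ b * ‖T θ‖ ^ 2 * ‖S θ - S θhat‖ ^ 2 := by positivity
        have t6 : b * ‖T θ‖ ^ 2 * c = 2 * (K ^ 2 * ‖T θ‖ ^ 2) := by
          rw [mul_right_comm, t4]; ring
        nlinarith
      have h2 := rpow_le_exp (u := 2 + b * ‖T θ‖ ^ 2) (ε := 1 / (4 * b)) hp (by positivity) (by positivity)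
      calc _ ≤ (2 + b * ‖T θ‖ ^ 2) ^ p * (D * Real.exp (-(1/2) * ‖T θ‖ ^ 2)) := by gcongr
        _ ≤ ((p / (1 / (4 * b))) ^ p * Real.exp (1 / (4 * b) * (2 + b * ‖T θ‖ ^ 2))) * (D * Real.exp (-(1/2) * ‖T θ‖ ^ 2)) := by gcongr
        _ = (p / (1 / (4 * b))) ^ p * D * (Real.exp (1 / (4 * b) * (2 + b * ‖T θ‖ ^ 2)) * Real.exp (-(1/2) * ‖T θ‖ ^ 2)) := by ring
        _ = (p / (1 / (4 * b))) ^ p * D * (Real.exp (2 / (4 * b)) * Real.exp (-(1/4) * ‖T θ‖ ^ 2)) := by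
          rw [← Real.exp_add, ← Real.exp_add]; congr 2; field_simp; ring
        _ = _ := by ring
        _ ≤ _ := le_rfl
    · exact (gauss_integrable T (by norm_num)).const_mul _
    · refine Eventually.of_forall fun θ => ?_
      have := ((ratio_tendsto (fun θhat => S θhat) (S θ) c hStend).rpow_const (p := p) (Or.inl one_ne_zero)).mul_const (φ θ)
      simpa using this
  rw [hφint] at key
  refine key.congr fun θhat => ?_
  rw [← integral_const_mul]
  refine integral_congr_ae (Eventually.of_forall fun θ => ?_)
  simp only
  rw [hS, hsub, Real.div_rpow (by positivity) (by positivity), Real.rpow_neg (by positivity)]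
  ring
end

section
/- Let B10^ind(θ̂) be the Bayes factor under the independent semi-conjugate prior defined below. Then as |θ̂| → ∞: B10^ind(θ̂) → 0 if ν0 < ν1; B10^ind(θ̂) → 1 if ν0 = ν1 (with s0 = s1); and B10^ind(θ̂) → ∞ if ν0 > ν1. -/
open MeasureTheory Filter Matrix

open scoped MatrixOrder in
lemma ipbf_factor {r : ℕ} {A : Matrix (Fin r) (Fin r) ℝ} (hA : A.PosDef) :
    ∃ (T : EuclideanSpace ℝ (Fin r) →L[ℝ] EuclideanSpace ℝ (Fin r)) (K : ℝ), 0 < K ∧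
      (∀ x : EuclideanSpace ℝ (Fin r), x.ofLp ⬝ᵥ A *ᵥ x.ofLp = ‖T x‖ ^ 2) ∧
      (∀ x, ‖x‖ ≤ K * ‖T x‖) ∧
      (LinearMap.det (T : EuclideanSpace ℝ (Fin r) →ₗ[ℝ] EuclideanSpace ℝ (Fin r))) ^ 2
        = A.det := by
  obtain ⟨B, hB⟩ := CStarAlgebra.nonneg_iff_eq_star_mul_self.mp hA.posSemidef.nonneg
  have hdet : B.det ^ 2 = A.det := by
    rw [hB, star_eq_conjTranspose, det_mul, det_conjTranspose]
    simp [sq]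
  have hB0 : IsUnit B.det := by
    rw [isUnit_iff_ne_zero]
    intro h
    have := hA.det_pos
    rw [← hdet, h] at this
    simp at this
  refine ⟨toEuclideanCLM (𝕜 := ℝ) B, ‖toEuclideanCLM (n := Fin r) (𝕜 := ℝ) B⁻¹‖ + 1,
    by positivity, ?_, ?_, ?_⟩
  · intro x
    rw [← real_inner_self_eq_norm_sq, EuclideanSpace.inner_eq_star_dotProduct, ofLp_toEuclideanCLM,
      hB, star_eq_conjTranspose, ← mulVec_mulVec, dotProduct_mulVec]
    simp [vecMul_transpose]
  · intro x
    have h1 : toEuclideanCLM (n := Fin r) (𝕜 := ℝ) B⁻¹ (toEuclideanCLM (𝕜 := ℝ) B x) = x := by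
      rw [← ContinuousLinearMap.mul_apply, ← map_mul, nonsing_inv_mul _ hB0, map_one]
      rfl
    have h2 := (toEuclideanCLM (n := Fin r) (𝕜 := ℝ) B⁻¹).le_opNorm (toEuclideanCLM (𝕜 := ℝ) B x)
    rw [h1] at h2
    have := norm_nonneg (toEuclideanCLM (𝕜 := ℝ) B x)
    linarith
  · rw [coe_toEuclideanCLM_eq_toEuclideanLin, ← hdet]
    congr 1
    exact LinearMap.det_toLpLin 2 B

lemma ipbf_poly (α C ε : ℝ) (hα : 0 ≤ α) (hC : 0 ≤ C) (hε : 0 < ε) :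
    ∃ D : ℝ, 0 ≤ D ∧ ∀ t : ℝ, 0 ≤ t → (1 + C * t) ^ α ≤ D * Real.exp (ε * t) := by
  have hp : 0 < ε + α * C := by positivity
  set δ := ε / (ε + α * C) with hδ
  have hδ0 : 0 < δ := by positivity
  have hδ1 : δ ≤ 1 := by
    rw [hδ, div_le_one hp]; nlinarith [mul_nonneg hα hC]
  have hδ2 : α * δ * C ≤ ε := by
    have : δ * (ε + α * C) = ε := by rw [hδ]; field_simp
    nlinarith
  refine ⟨(δ⁻¹) ^ α, by positivity, fun t ht => ?_⟩
  have h1 : 1 + C * t ≤ δ⁻¹ * Real.exp (δ * C * t) := by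
    have h2 := Real.add_one_le_exp (δ * C * t)
    rw [inv_mul_eq_div, le_div_iff₀ hδ0]
    nlinarith
  calc (1 + C * t) ^ α ≤ (δ⁻¹ * Real.exp (δ * C * t)) ^ α :=
        Real.rpow_le_rpow (by positivity) h1 hα
    _ = δ⁻¹ ^ α * Real.exp (δ * C * t * α) := by
        rw [Real.mul_rpow (by positivity) (by positivity), ← Real.exp_mul]
    _ ≤ _ := by
        refine mul_le_mul_of_nonneg_left (Real.exp_le_exp.mpr ?_) (by positivity)
        nlinarith [mul_le_mul_of_nonneg_right hδ2 ht]

lemma ipbf_ratio {ι : Type*} {F : Filter ι} (u v : ι → ℝ) (K a0 a1 : ℝ)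
    (hu : Tendsto u F atTop) (h : ∀ i, |v i - u i| ≤ K) :
    Tendsto (fun i => (a0 + u i ^ 2) / (a1 + v i ^ 2)) F (nhds 1) := by
  have hinv : Tendsto (fun i => (u i)⁻¹) F (nhds 0) := tendsto_inv_atTop_zero.comp hu
  have hvu : Tendsto (fun i => (v i - u i) * (u i)⁻¹) F (nhds 0) := by
    refine squeeze_zero_norm (a := fun i => K * |(u i)⁻¹|) (fun i => ?_) ?_
    · rw [norm_mul]
      exact mul_le_mul_of_nonneg_right (h i) (norm_nonneg _)
    · simpa using hinv.abs.const_mul K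
  have h1 : Tendsto (fun i => (a0 * (u i)⁻¹ ^ 2 + 1) /
      (a1 * (u i)⁻¹ ^ 2 + ((v i - u i) * (u i)⁻¹ + 1) ^ 2)) F
      (nhds ((a0 * 0 ^ 2 + 1) / (a1 * 0 ^ 2 + (0 + 1) ^ 2))) := by
    refine Tendsto.div ?_ ?_ (by norm_num)
    · exact ((hinv.pow 2).const_mul a0).add_const 1
    · exact ((hinv.pow 2).const_mul a1).add ((hvu.add_const 1).pow 2)
  norm_num at h1
  refine h1.congr' ?_
  filter_upwards [hu.eventually_gt_atTop 0] with i hi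
  have e1 : a0 * ((u i) ^ 2)⁻¹ + 1 = (a0 + u i ^ 2) * ((u i) ^ 2)⁻¹ := by
    field_simp
  have e2 : a1 * ((u i) ^ 2)⁻¹ + ((v i - u i) * (u i)⁻¹ + 1) ^ 2
      = (a1 + v i ^ 2) * ((u i) ^ 2)⁻¹ := by
    field_simp; ring
  rw [e1, e2]
  exact mul_div_mul_right _ _ (by positivity)

lemma ipbf_gauss {r : ℕ} (S : EuclideanSpace ℝ (Fin r) →L[ℝ] EuclideanSpace ℝ (Fin r))
    (hS : LinearMap.det (S : EuclideanSpace ℝ (Fin r) →ₗ[ℝ] EuclideanSpace ℝ (Fin r)) ≠ 0) :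
    ∫ θ, Real.exp (-‖S θ‖ ^ 2 / 2) =
      |(LinearMap.det (S : EuclideanSpace ℝ (Fin r) →ₗ[ℝ] EuclideanSpace ℝ (Fin r)))⁻¹| *
        (2 * Real.pi) ^ ((r : ℝ) / 2) := by
  have h1 := Measure.map_linearMap_addHaar_eq_smul_addHaar
    (volume : Measure (EuclideanSpace ℝ (Fin r))) hS
  have h2 : ∫ y, Real.exp (-‖y‖ ^ 2 / 2) ∂(Measure.map S volume) =
      ∫ θ, Real.exp (-‖S θ‖ ^ 2 / 2) :=
    integral_map S.continuous.measurable.aemeasurable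
      (Continuous.aestronglyMeasurable (by fun_prop))
  have h3 := GaussianFourier.integral_rexp_neg_mul_sq_norm
    (V := EuclideanSpace ℝ (Fin r)) (b := 1 / 2) (by norm_num)
  rw [← h2]
  change ∫ y, Real.exp (-‖y‖ ^ 2 / 2) ∂(Measure.map (S : EuclideanSpace ℝ (Fin r) →ₗ[ℝ] EuclideanSpace ℝ (Fin r)) volume) = _
  rw [h1, integral_smul_measure, ENNReal.toReal_ofReal (abs_nonneg _), smul_eq_mul]
  congr 1
  have e : (Real.pi / (1 / 2)) = 2 * Real.pi := by ring
  rw [e, finrank_euclideanSpace, Fintype.card_fin] at h3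
  rw [← h3]
  congr 1
  ext v
  congr 1
  ring

lemma ipbf_gauss_integrable {r : ℕ} (b : ℝ) (hb : 0 < b) :
    Integrable (fun θ : EuclideanSpace ℝ (Fin r) => Real.exp (-b * ‖θ‖ ^ 2)) := by
  by_contra hcon
  have h3 := GaussianFourier.integral_rexp_neg_mul_sq_norm
    (V := EuclideanSpace ℝ (Fin r)) hb
  rw [integral_undef hcon] at h3
  have : 0 < (Real.pi / b) ^ ((Module.finrank ℝ (EuclideanSpace ℝ (Fin r)) : ℝ) / 2) := by
    positivity
  linarith

lemma ipbf_main {r : ℕ} (T S : EuclideanSpace ℝ (Fin r) →L[ℝ] EuclideanSpace ℝ (Fin r))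
    (K L : ℝ) (hK : 0 < K) (hL : 0 < L) (hT : ∀ x, ‖x‖ ≤ K * ‖T x‖) (hS : ∀ x, ‖x‖ ≤ L * ‖S x‖)
    (α a0 a1 : ℝ) (hα : 0 ≤ α) (ha0 : 0 < a0) (ha1 : 0 < a1) :
    Tendsto (fun h => ∫ θ, ((a0 + ‖T h‖ ^ 2) / (a1 + ‖T (θ - h)‖ ^ 2)) ^ α
        * Real.exp (-‖S θ‖ ^ 2 / 2))
      (comap (fun h : EuclideanSpace ℝ (Fin r) => ‖h‖) atTop)
      (nhds (∫ θ, Real.exp (-‖S θ‖ ^ 2 / 2))) := by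
  obtain ⟨D, hD, hDt⟩ := ipbf_poly α (‖T‖ ^ 2) (1 / (4 * L ^ 2)) hα (by positivity) (by positivity)
  set M := a0 / a1 + 2 + 2 / a1 with hM
  have hM0 : 0 < M := by positivity
  refine tendsto_integral_filter_of_dominated_convergence
    (fun θ => M ^ α * D * Real.exp (-(1 / (4 * L ^ 2)) * ‖θ‖ ^ 2)) ?_ ?_ ?_ ?_
  · refine Eventually.of_forall fun h => Continuous.aestronglyMeasurable ?_
    refine Continuous.mul (Continuous.rpow_const ?_ fun _ => Or.inr hα) (by fun_prop)
    refine Continuous.div (by fun_prop) (by fun_prop) fun x => ?_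
    positivity
  · refine Eventually.of_forall fun h => Eventually.of_forall fun θ => ?_
    rw [Real.norm_of_nonneg (by positivity)]
    have hw : ‖T θ‖ ^ 2 ≤ ‖T‖ ^ 2 * ‖θ‖ ^ 2 := by
      rw [← mul_pow]; gcongr; exact T.le_opNorm θ
    have hu : ‖T h‖ ≤ ‖T (θ - h)‖ + ‖T θ‖ := by
      have : T h = T θ - T (θ - h) := by simp
      rw [this, add_comm]; exact norm_sub_le _ _
    have hu2 : ‖T h‖ ^ 2 ≤ 2 * ‖T (θ - h)‖ ^ 2 + 2 * ‖T θ‖ ^ 2 := by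
      nlinarith [sq_nonneg (‖T (θ - h)‖ - ‖T θ‖), norm_nonneg (T h)]
    have hr : (a0 + ‖T h‖ ^ 2) / (a1 + ‖T (θ - h)‖ ^ 2) ≤ M * (1 + ‖T‖ ^ 2 * ‖θ‖ ^ 2) := by
      rw [div_le_iff₀ (by positivity)]
      have e : M * a1 = a0 + 2 * a1 + 2 := by rw [hM]; field_simp
      have e2 : 2 ≤ M := by
        have : 0 ≤ a0 / a1 := by positivity
        have : 0 ≤ 2 / a1 := by positivity
        linarith
      set V := ‖T (θ - h)‖ ^ 2
      set W := ‖T‖ ^ 2 * ‖θ‖ ^ 2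
      have hV : 0 ≤ V := by positivity
      have hW : 0 ≤ W := by positivity
      have e3 : 2 * W ≤ M * a1 * W := by
        rw [e]; nlinarith
      have e4 : 2 * V ≤ M * V := by nlinarith
      have e5 : 0 ≤ M * W * V := by positivity
      nlinarith
    have hs : ‖θ‖ ^ 2 ≤ L ^ 2 * ‖S θ‖ ^ 2 := by
      rw [← mul_pow]; gcongr; exact hS θ
    calc _ ≤ (M * (1 + ‖T‖ ^ 2 * ‖θ‖ ^ 2)) ^ α * Real.exp (-(1 / (2 * L ^ 2)) * ‖θ‖ ^ 2) := by
          gcongr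
          have : ‖θ‖ ^ 2 / L ^ 2 ≤ ‖S θ‖ ^ 2 := by
            rw [div_le_iff₀ (by positivity)]; linarith
          have e : -(1 / (2 * L ^ 2)) * ‖θ‖ ^ 2 = -(‖θ‖ ^ 2 / L ^ 2) / 2 := by
            field_simp
          rw [e]; linarith
      _ ≤ M ^ α * (D * Real.exp (1 / (4 * L ^ 2) * ‖θ‖ ^ 2))
          * Real.exp (-(1 / (2 * L ^ 2)) * ‖θ‖ ^ 2) := by
          rw [Real.mul_rpow hM0.le (by positivity)]
          gcongr
          exact hDt _ (by positivity)
      _ = _ := by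
          rw [mul_assoc, mul_assoc, mul_assoc, ← Real.exp_add]
          congr 4
          field_simp
          ring
  · exact (ipbf_gauss_integrable _ (by positivity)).const_mul _
  · refine Eventually.of_forall fun θ => ?_
    have hu : Tendsto (fun h => ‖T h‖)
        (comap (fun h : EuclideanSpace ℝ (Fin r) => ‖h‖) atTop) atTop := by
      refine tendsto_atTop_mono (f := fun h => K⁻¹ * ‖h‖) (fun h => ?_)
        (tendsto_comap.const_mul_atTop (by positivity))
      rw [inv_mul_le_iff₀ hK]; exact hT h
    have h1 := ipbf_ratio (fun h => ‖T h‖) (fun h => ‖T (θ - h)‖) ‖T θ‖ a0 a1 hu (fun h => by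
      rw [map_sub, norm_sub_rev]
      refine (abs_norm_sub_norm_le _ _).trans ?_
      simp)
    have h2 := (h1.rpow_const (p := α) (Or.inr hα)).mul_const (Real.exp (-‖S θ‖ ^ 2 / 2))
    simpa using h2


/-- For the Bayes factor under the independent semi-conjugate prior,
as |θ̂| → ∞: B10 → 0 if ν0 < ν1; B10 → 1 if ν0 = ν1 (with s0 = s1, in which case the
constant C2 equals 1); B10 → ∞ if ν0 > ν1. -/
theorem independence_prior_bayes_factor_limits
    (n r1 r2 : ℕ) (hn : 1 ≤ n) (hr1 : 1 ≤ r1)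
    (Q Ω : Matrix (Fin r1) (Fin r1) ℝ) (hQ : Q.PosDef) (hΩ : Ω.PosDef)
    (ν0 ν1 : ℝ) (hν0 : 0 ≤ ν0) (hν1 : 0 ≤ ν1)
    (hdf : 0 < (n : ℝ) - r2 + min ν0 ν1)
    (s0sq s1sq : ℝ) (hs0 : 0 < s0sq) (hs1 : 0 < s1sq)
    (sysq : ℝ) (hsy : 0 < sysq)
    (C2 : ℝ) (hC2 : 0 < C2)
    (φ : EuclideanSpace ℝ (Fin r1) → ℝ)
    (hφ : ∀ θ : EuclideanSpace ℝ (Fin r1),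
      φ θ = (2 * Real.pi) ^ (-(r1:ℝ)/2) * Ω.det ^ (-(1:ℝ)/2) *
        Real.exp (-(θ ⬝ᵥ (Ω⁻¹).mulVec θ) / 2))
    (B10 : EuclideanSpace ℝ (Fin r1) → ℝ)
    (hB10 : ∀ θhat : EuclideanSpace ℝ (Fin r1),
      B10 θhat = C2 *
        (∫ θ : EuclideanSpace ℝ (Fin r1),
          (ν1 * s1sq + sysq + (θ - θhat) ⬝ᵥ Q.mulVec (θ - θhat))
            ^ (-(((n:ℝ) - r2 + ν1) / 2)) * φ θ) /
        (ν0 * s0sq + sysq + θhat ⬝ᵥ Q.mulVec θhat)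
          ^ (-(((n:ℝ) - r2 + ν0) / 2))) :
    (ν0 < ν1 →
      Tendsto B10 (comap (fun θhat : EuclideanSpace ℝ (Fin r1) => ‖θhat‖) atTop) (nhds 0)) ∧
    (ν0 = ν1 → s0sq = s1sq → C2 = 1 →
      Tendsto B10 (comap (fun θhat : EuclideanSpace ℝ (Fin r1) => ‖θhat‖) atTop) (nhds 1)) ∧
    (ν1 < ν0 →
      Tendsto B10 (comap (fun θhat : EuclideanSpace ℝ (Fin r1) => ‖θhat‖) atTop) atTop) := by

  obtain ⟨T, K, hK, hTq, hTK, -⟩ := ipbf_factor hQ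
  obtain ⟨S, L, hL, hSq, hSL, hSdet⟩ := ipbf_factor hΩ.inv
  have hα : 0 < ((n:ℝ) - r2 + ν1) / 2 := by
    have := min_le_right ν0 ν1
    linarith
  set α := ((n:ℝ) - r2 + ν1) / 2 with hαdef
  set β := ((n:ℝ) - r2 + ν0) / 2 with hβdef
  have hβα : β - α = (ν0 - ν1) / 2 := by rw [hαdef, hβdef]; ring
  have ha0 : 0 < ν0 * s0sq + sysq := by positivity
  have ha1 : 0 < ν1 * s1sq + sysq := by positivity
  set a0 := ν0 * s0sq + sysq
  set a1 := ν1 * s1sq + sysq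
  set c := (2 * Real.pi) ^ (-(r1:ℝ)/2) * Ω.det ^ (-(1:ℝ)/2) with hc
  have hΩd := hΩ.det_pos
  have hdetinv : (Ω⁻¹).det = (Ω.det)⁻¹ := by
    rw [det_nonsing_inv, Ring.inverse_eq_inv']
  rw [hdetinv] at hSdet
  have hS0 : LinearMap.det (S : EuclideanSpace ℝ (Fin r1) →ₗ[ℝ] EuclideanSpace ℝ (Fin r1)) ≠ 0 := by
    intro h
    rw [h] at hSdet
    have : 0 < (Ω.det)⁻¹ := by positivity
    rw [← hSdet] at this
    simp at this
  have hcint : c * ∫ θ, Real.exp (-‖S θ‖ ^ 2 / 2) = 1 := by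
    rw [ipbf_gauss S hS0]
    have e : |(LinearMap.det (S : EuclideanSpace ℝ (Fin r1) →ₗ[ℝ] EuclideanSpace ℝ (Fin r1)))⁻¹|
        = Ω.det ^ ((1:ℝ)/2) := by
      rw [← Real.sqrt_eq_rpow, ← Real.sqrt_sq_eq_abs, inv_pow, hSdet, inv_inv]
    have hpi : (0:ℝ) < 2 * Real.pi := by positivity
    rw [e, hc]
    calc _ = ((2 * Real.pi) ^ (-(r1:ℝ)/2) * (2 * Real.pi) ^ ((r1:ℝ)/2)) *
          (Ω.det ^ (-(1:ℝ)/2) * Ω.det ^ ((1:ℝ)/2)) := by ring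
      _ = 1 := by
        rw [← Real.rpow_add hpi, ← Real.rpow_add hΩd]
        ring_nf
        simp
  have hmain := (ipbf_main T S K L hK hL hTK hSL α a0 a1 hα.le ha0 ha1).const_mul c
  rw [hcint] at hmain
  set I := fun h => c * ∫ θ, ((a0 + ‖T h‖ ^ 2) / (a1 + ‖T (θ - h)‖ ^ 2)) ^ α
        * Real.exp (-‖S θ‖ ^ 2 / 2) with hI
  have hB : B10 = fun h => C2 * I h * (a0 + ‖T h‖ ^ 2) ^ (β - α) := by
    funext h
    have hp : 0 < a0 + ‖T h‖ ^ 2 := by positivity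
    rw [hB10 h, hTq h]
    have e : ∀ θ : EuclideanSpace ℝ (Fin r1),
        (a1 + (θ - h).ofLp ⬝ᵥ Q *ᵥ (θ.ofLp - h.ofLp)) ^ (-α) * φ θ =
        ((a0 + ‖T h‖ ^ 2) ^ (-α) * c) * (((a0 + ‖T h‖ ^ 2) / (a1 + ‖T (θ - h)‖ ^ 2)) ^ α
        * Real.exp (-‖S θ‖ ^ 2 / 2)) := by
      intro θ
      have e1 := hTq (θ - h)
      have e2 : (θ - h).ofLp = θ.ofLp - h.ofLp := rfl
      rw [← e2, e1, hφ θ, hSq θ, Real.div_rpow hp.le (by positivity), Real.rpow_neg hp.le,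
        Real.rpow_neg (by positivity)]
      have : (a0 + ‖T h‖ ^ 2) ^ α ≠ 0 := by positivity
      field_simp
    simp_rw [e]
    rw [integral_const_mul, hI, Real.rpow_neg hp.le, Real.rpow_neg hp.le, Real.rpow_sub hp]
    field_simp
  have hq : Tendsto (fun h => a0 + ‖T h‖ ^ 2)
      (comap (fun h : EuclideanSpace ℝ (Fin r1) => ‖h‖) atTop) atTop := by
    refine tendsto_atTop_add_const_left _ _ ((tendsto_pow_atTop two_ne_zero).comp ?_)
    refine tendsto_atTop_mono (f := fun h => K⁻¹ * ‖h‖) (fun h => ?_)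
      (tendsto_comap.const_mul_atTop (by positivity))
    rw [inv_mul_le_iff₀ hK]; exact hTK h
  have hCI := hmain.const_mul C2
  rw [hB]
  refine ⟨fun hlt => ?_, fun heq _ hC => ?_, fun hlt => ?_⟩
  · have h1 : Tendsto (fun h => (a0 + ‖T h‖ ^ 2) ^ (β - α))
        (comap (fun h : EuclideanSpace ℝ (Fin r1) => ‖h‖) atTop) (nhds 0) := by
      have := (tendsto_rpow_neg_atTop (y := α - β) (by linarith)).comp hq
      simpa [Function.comp_def] using this
    simpa using hCI.mul h1
  · have e : β - α = 0 := by rw [hβα, heq]; ring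
    simp only [e, Real.rpow_zero, mul_one, hC, one_mul]
    exact hmain
  · have h1 := (tendsto_rpow_atTop (y := β - α) (by linarith)).comp hq
    exact hCI.pos_mul_atTop (by simpa using hC2) h1
end

section
/- For the g-prior with ν0 = ν1 = 0, whenever ĝ := (n − r2 − r1)t²/(r1(n−1)) − 1 > 0, the value g = ĝ maximizes the Bayes factor B10(g) over g > 0, and the maximized Bayes factor equals B10(ĝ) = (r1(n−1)/(t²(n−r1−r2)))^{r1/2} · ((n−1+t²)(n−r1−r2)/((n−1)(n−r2)))^{(n−r2)/2}; moreover B10(ĝ) → ∞ as |t| → ∞, so the adaptive g-prior is information consistent. -/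
open MeasureTheory Filter

/-- The Bayes factor with the scale removed. -/
lemma bf_form (r N s c u : ℝ) (hs : 0 < s) (hc : 0 < c) (hu : 0 < u) :
    u ^ (-r/2) * (s + c * s / u) ^ (-(N/2)) / (s + c * s) ^ (-(N/2)) =
      u ^ (-r/2) * ((1 + c) / (1 + c / u)) ^ (N/2) := by
  have h1 : 0 < s + c * s / u := by positivity
  have h2 : 0 < s + c * s := by positivity
  have h3 : (1 + c) / (1 + c / u) = (s + c * s) / (s + c * s / u) := by
    have : 0 < 1 + c / u := by positivity
    rw [div_eq_div_iff this.ne' h1.ne']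
    field_simp
  rw [h3, Real.div_rpow h2.le h1.le, Real.rpow_neg h1.le, Real.rpow_neg h2.le]
  field_simp

lemma bf_max (r N c u u0 : ℝ) (hr : 0 < r) (hN : r < N) (hc : 0 < c) (hu : 0 < u)
    (hu0 : u0 = (N - r) * c / r) :
    u ^ (-r/2) * ((1 + c) / (1 + c / u)) ^ (N/2) ≤
      u0 ^ (-r/2) * ((1 + c) / (1 + c / u0)) ^ (N/2) := by
  have hNr : 0 < N - r := by linarith
  have hN0 : 0 < N := by linarith
  have hu0p : 0 < u0 := by rw [hu0]; positivity
  have key := Real.geom_mean_le_arith_mean2_weighted (w₁ := (N - r)/N) (w₂ := r/N)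
    (p₁ := u/u0) (p₂ := 1) (by positivity) (by positivity) (by positivity) (by positivity)
    (by field_simp; ring)
  rw [Real.one_rpow, mul_one] at key
  have hy : (N - r)/N * (u/u0) + r/N * 1 = (u + c)/(u0 + c) := by
    rw [hu0]; field_simp; ring
  rw [hy] at key
  have key2 := Real.log_le_log (by positivity) key
  rw [Real.log_rpow (by positivity), Real.log_div hu.ne' hu0p.ne',
    Real.log_div (by positivity) (by positivity)] at key2
  have key3 : (N - r) * (Real.log u - Real.log u0) ≤
      N * (Real.log (u + c) - Real.log (u0 + c)) := by
    have := mul_le_mul_of_nonneg_left key2 hN0.le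
    calc _ = N * ((N - r) / N * (Real.log u - Real.log u0)) := by field_simp
      _ ≤ _ := this
  have hlog : ∀ v : ℝ, 0 < v → Real.log (v ^ (-r/2) * ((1 + c) / (1 + c / v)) ^ (N/2)) =
      -r/2 * Real.log v + N/2 * (Real.log (1 + c) + Real.log v - Real.log (v + c)) := by
    intro v hv
    have e : (1 + c) / (1 + c / v) = (1 + c) * v / (v + c) := by field_simp
    rw [Real.log_mul (by positivity) (by positivity), Real.log_rpow hv,
      Real.log_rpow (by positivity), e, Real.log_div (by positivity) (by positivity),
      Real.log_mul (by positivity) (by positivity)]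
  rw [← Real.log_le_log_iff (by positivity) (by positivity), hlog u hu, hlog u0 hu0p]
  linarith

/-- For the g-prior with ν0 = ν1 = 0, whenever
ĝ = (n−r2−r1)t²/(r1(n−1)) − 1 > 0, the value g = ĝ maximizes the Bayes factor over g > 0,
the maximized Bayes factor has the stated closed form, and it tends to ∞ as t² → ∞
(information consistency of the adaptive g-prior). -/
theorem adaptive_g_prior_maximized_bayes_factor
    (n r1 r2 : ℕ) (hr1 : 1 ≤ r1) (hnr : r1 + r2 < n)
    (sysq : ℝ) (hsy : 0 < sysq)
    (B10 : ℝ → ℝ → ℝ)   -- B10 tsq g, where tsq = t² = θ̂ᵀQθ̂/(s_y²/(n−1))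
    (hB10 : ∀ tsq g : ℝ, B10 tsq g =
      (1 + g) ^ (-(r1:ℝ)/2) *
        (sysq + tsq * sysq / ((n:ℝ) - 1) / (1 + g)) ^ (-(((n:ℝ) - r2) / 2)) /
        (sysq + tsq * sysq / ((n:ℝ) - 1)) ^ (-(((n:ℝ) - r2) / 2)))
    (ghat : ℝ → ℝ)
    (hghat : ∀ tsq : ℝ, ghat tsq = ((n:ℝ) - r2 - r1) * tsq / ((r1:ℝ) * ((n:ℝ) - 1)) - 1) :
    (∀ tsq : ℝ, 0 < tsq → 0 < ghat tsq →
      ∀ g : ℝ, 0 < g → B10 tsq g ≤ B10 tsq (ghat tsq)) ∧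
    (∀ tsq : ℝ, 0 < tsq → 0 < ghat tsq →
      B10 tsq (ghat tsq) =
        ((r1:ℝ) * ((n:ℝ) - 1) / (tsq * ((n:ℝ) - r1 - r2))) ^ ((r1:ℝ) / 2) *
          (((n:ℝ) - 1 + tsq) * ((n:ℝ) - r1 - r2) / (((n:ℝ) - 1) * ((n:ℝ) - r2)))
            ^ (((n:ℝ) - r2) / 2)) ∧
    Tendsto (fun tsq : ℝ => B10 tsq (ghat tsq)) atTop atTop := by
  have hr : (0:ℝ) < r1 := by exact_mod_cast hr1
  have hN : (r1:ℝ) + r2 < n := by exact_mod_cast hnr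
  have hr2 : (0:ℝ) ≤ r2 := Nat.cast_nonneg _
  have hr1' : (1:ℝ) ≤ r1 := by exact_mod_cast hr1
  have hn : (0:ℝ) < (n:ℝ) - 1 := by linarith
  have hNr : (0:ℝ) < (n:ℝ) - r1 - r2 := by linarith
  have hN0 : (0:ℝ) < (n:ℝ) - r2 := by linarith
  have form : ∀ tsq g : ℝ, 0 < tsq → 0 < g → B10 tsq g = (1 + g) ^ (-(r1:ℝ)/2) *
      ((1 + tsq / ((n:ℝ) - 1)) / (1 + tsq / ((n:ℝ) - 1) / (1 + g))) ^ (((n:ℝ) - r2)/2) := by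
    intro tsq g ht hg
    rw [hB10, ← bf_form (r1:ℝ) ((n:ℝ) - r2) sysq (tsq / ((n:ℝ) - 1)) (1 + g) hsy
      (by positivity) (by linarith)]
    rw [mul_div_right_comm tsq sysq]
  have hu0 : ∀ tsq : ℝ, 1 + ghat tsq =
      ((n:ℝ) - r2 - r1) * (tsq / ((n:ℝ) - 1)) / r1 := by
    intro tsq
    rw [hghat]; field_simp; ring
  have closed : ∀ tsq : ℝ, 0 < tsq → 0 < ghat tsq →
      B10 tsq (ghat tsq) =
        ((r1:ℝ) * ((n:ℝ) - 1) / (tsq * ((n:ℝ) - r1 - r2))) ^ ((r1:ℝ) / 2) *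
          (((n:ℝ) - 1 + tsq) * ((n:ℝ) - r1 - r2) / (((n:ℝ) - 1) * ((n:ℝ) - r2)))
            ^ (((n:ℝ) - r2) / 2) := by
    intro tsq ht hg
    have hpos : 0 < 1 + ghat tsq := by linarith
    have hc2 : (n:ℝ) - r2 - r1 = (n:ℝ) - r1 - r2 := by ring
    rw [form tsq _ ht hg]
    congr 1
    · rw [neg_div, Real.rpow_neg hpos.le, ← Real.inv_rpow hpos.le, hu0, hc2]
      congr 1
      field_simp
    · congr 1
      rw [hu0, hc2]
      have : 1 + tsq / ((n:ℝ) - 1) / (((n:ℝ) - r1 - r2) * (tsq / ((n:ℝ) - 1)) / r1) =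
          ((n:ℝ) - r2) / ((n:ℝ) - r1 - r2) := by
        field_simp; ring
      rw [this]
      field_simp
  refine ⟨?_, closed, ?_⟩
  · intro tsq ht hg g hg0
    rw [form tsq g ht hg0, form tsq _ ht hg]
    exact bf_max (r1:ℝ) ((n:ℝ) - r2) _ _ _ hr (by linarith) (by positivity) (by linarith)
      (hu0 tsq)
  · set A : ℝ := (r1:ℝ) * ((n:ℝ) - 1) / ((n:ℝ) - r1 - r2) with hA
    set D : ℝ := ((n:ℝ) - r1 - r2) / (((n:ℝ) - 1) * ((n:ℝ) - r2)) with hD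
    have hAp : 0 < A := by positivity
    have hDp : 0 < D := by positivity
    have hlim : Tendsto (fun t : ℝ => A ^ ((r1:ℝ)/2) * D ^ (((n:ℝ) - r2)/2) *
        t ^ (((n:ℝ) - r1 - r2)/2)) atTop atTop :=
      (tendsto_rpow_atTop (by positivity)).const_mul_atTop (by positivity)
    refine tendsto_atTop_mono' _ ?_ hlim
    filter_upwards [eventually_gt_atTop 0, eventually_gt_atTop A] with t ht htA
    have hg : 0 < ghat t := by
      have h1 : 1 + ghat t = t / A := by
        rw [hu0, hA]; field_simp; ring
      have h2 : 1 < t / A := (one_lt_div hAp).2 htA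
      linarith
    rw [closed t ht hg]
    have e1 : (r1:ℝ) * ((n:ℝ) - 1) / (t * ((n:ℝ) - r1 - r2)) = A / t := by
      rw [hA]; field_simp
    have e2 : ((n:ℝ) - 1 + t) * ((n:ℝ) - r1 - r2) / (((n:ℝ) - 1) * ((n:ℝ) - r2)) =
        D * ((n:ℝ) - 1 + t) := by
      rw [hD]; field_simp
    have e3 : t ^ (((n:ℝ) - r1 - r2)/2) = t ^ (((n:ℝ) - r2)/2) / t ^ ((r1:ℝ)/2) := by
      rw [← Real.rpow_sub ht]; congr 1; ring
    rw [e1, e2, e3, Real.div_rpow hAp.le ht.le]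
    have e4 : (D * t) ^ (((n:ℝ) - r2)/2) ≤ (D * ((n:ℝ) - 1 + t)) ^ (((n:ℝ) - r2)/2) := by
      apply Real.rpow_le_rpow (by positivity) _ (by positivity)
      apply mul_le_mul_of_nonneg_left _ hDp.le
      linarith
    calc _ = A ^ ((r1:ℝ)/2) / t ^ ((r1:ℝ)/2) * (D * t) ^ (((n:ℝ) - r2)/2) := by
          rw [Real.mul_rpow hDp.le ht.le]; ring
      _ ≤ _ := mul_le_mul_of_nonneg_left e4 (by positivity)
end
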